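/- arXiv:1804.04964 — 2 statements merged into one kernel-verified Lean document; each statement's English description precedes it below -/
import Mathlib

section
/- If A₁,…,A_n are injective MPS tensors on n ≥ 3 sites whose state is translationally invariant (the state equals its cyclic shift), then all bond dimensions D₁ = D₂ = ⋯ = D_n are equal, and there exists a single injective tensor B with the same bond dimension such that the state equals the translationally invariant MPS built from B: ∑Tr(A₁^{i₁}⋯A_n^{i_n})|i₁…i_n⟩ = ∑Tr(B^{i₁}⋯B^{i_n})|i₁…i_n⟩. -/
open Matrix

/-- Product `A_a^{i_a} A_{a+1}^{i_{a+1}} ⋯ A_{a+len-1}^{i_{a+len-1}}` of MPS matrices. -/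
noncomputable def mprod (D d : ℕ → ℕ)
    (A : ∀ k, Fin (d k) → Matrix (Fin (D k)) (Fin (D (k + 1))) ℂ)
    (i : ∀ k, Fin (d k)) (a : ℕ) : (len : ℕ) → Matrix (Fin (D a)) (Fin (D (a + len))) ℂ
  | 0 => (1 : Matrix (Fin (D a)) (Fin (D a)) ℂ)
  | len + 1 => mprod D d A i a len * A (a + len) (i (a + len))

/-- The coefficient `Tr(A_0^{i_0} ⋯ A_{n-1}^{i_{n-1}})` of the closed (ring) MPS. -/
noncomputable def mpsCoeff (n : ℕ) (D d : ℕ → ℕ)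
    (A : ∀ k, Fin (d k) → Matrix (Fin (D k)) (Fin (D (k + 1))) ℂ)
    (h : D n = D 0) (i : ∀ k, Fin (d k)) : ℂ :=
  ∑ α : Fin (D 0),
    mprod D d A i 0 n α (Fin.cast (show D 0 = D (0 + n) by rw [Nat.zero_add]; exact h.symm) α)

/-- Injectivity of the block of `len` consecutive MPS tensors starting at site `a`. -/
def blockInj (D d : ℕ → ℕ)
    (A : ∀ k, Fin (d k) → Matrix (Fin (D k)) (Fin (D (k + 1))) ℂ)
    (a len : ℕ) : Prop :=
  Function.Injective fun X : Matrix (Fin (D a)) (Fin (D (a + len))) ℂ =>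
    fun i : ∀ k, Fin (d k) => (mprod D d A i a len * Xᵀ).trace

section Generic

theorem span_of_inj {α β I : Type*} [Fintype α] [Fintype β] [DecidableEq α] [DecidableEq β]
    (P : I → Matrix α β ℂ)
    (h : Function.Injective fun X : Matrix α β ℂ => fun i => (P i * Xᵀ).trace) :
    Submodule.span ℂ (Set.range P) = ⊤ := by
  by_contra hne
  obtain ⟨f, hf, hle⟩ := Submodule.exists_le_ker_of_lt_top _ (lt_top_iff_ne_top.mpr hne)
  have key : ∀ M : Matrix α β ℂ,
      f M = (M * (Matrix.of fun a b => f (Matrix.single a b 1))ᵀ).trace := by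
    intro M
    conv_lhs => rw [Matrix.matrix_eq_sum_single M]
    simp only [map_sum, Matrix.trace, Matrix.diag, Matrix.mul_apply, Matrix.transpose_apply,
      Matrix.of_apply]
    refine Finset.sum_congr rfl fun a _ => Finset.sum_congr rfl fun b _ => ?_
    have : Matrix.single a b (M a b) = M a b • Matrix.single a b (1 : ℂ) := by
      simp [Matrix.smul_single]
    rw [this, map_smul, smul_eq_mul]
  have h0 : (Matrix.of fun a b => f (Matrix.single a b 1)) = (0 : Matrix α β ℂ) := by
    apply h
    funext i
    have : f (P i) = 0 := hle (Submodule.subset_span ⟨i, rfl⟩)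
    simp only
    rw [← key, this]
    simp
  apply hf
  ext M
  rw [key, h0]
  simp

theorem inj_of_span {α β I : Type*} [Fintype α] [Fintype β] [DecidableEq α] [DecidableEq β]
    (P : I → Matrix α β ℂ) (h : Submodule.span ℂ (Set.range P) = ⊤) :
    Function.Injective fun X : Matrix α β ℂ => fun i => (P i * Xᵀ).trace := by
  intro X Y hXY
  have : ∀ M : Matrix α β ℂ, (M * Xᵀ).trace = (M * Yᵀ).trace := by
    intro M
    have hM : M ∈ Submodule.span ℂ (Set.range P) := by rw [h]; trivial
    induction hM using Submodule.span_induction with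
    | mem x hx => obtain ⟨i, rfl⟩ := hx; exact congrFun hXY i
    | zero => simp
    | add x y _ _ hx hy => simp [Matrix.add_mul, hx, hy]
    | smul a x _ hx => simp [hx]
  have := (Matrix.ext_iff_trace_mul_left (A := Xᵀ) (B := Yᵀ)).2 this
  exact Matrix.transpose_injective this

/-- products of spanning sets span -/
theorem span_mul {α β γ I J : Type*} [Fintype α] [Fintype β] [Fintype γ] [DecidableEq α]
    [DecidableEq β] [DecidableEq γ] [Nonempty β]
    (P : I → Matrix α β ℂ) (Q : J → Matrix β γ ℂ)
    (hP : Submodule.span ℂ (Set.range P) = ⊤) (hQ : Submodule.span ℂ (Set.range Q) = ⊤) :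
    Submodule.span ℂ (Set.range fun p : I × J => P p.1 * Q p.2) = ⊤ := by
  set S := Submodule.span ℂ (Set.range fun p : I × J => P p.1 * Q p.2) with hS
  have h1 : ∀ (M : Matrix α β ℂ) (N : Matrix β γ ℂ), M * N ∈ S := by
    intro M N
    have hM : M ∈ Submodule.span ℂ (Set.range P) := by rw [hP]; trivial
    have hN : N ∈ Submodule.span ℂ (Set.range Q) := by rw [hQ]; trivial
    induction hM using Submodule.span_induction with
    | mem x hx =>
      obtain ⟨i, rfl⟩ := hx
      induction hN using Submodule.span_induction with
      | mem y hy => obtain ⟨j, rfl⟩ := hy; exact Submodule.subset_span ⟨(i, j), rfl⟩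
      | zero => simp
      | add x y _ _ hx hy => rw [Matrix.mul_add]; exact S.add_mem hx hy
      | smul a x _ hx => rw [Matrix.mul_smul]; exact S.smul_mem _ hx
    | zero => simp
    | add x y _ _ hx hy => rw [Matrix.add_mul]; exact S.add_mem hx hy
    | smul a x _ hx => rw [Matrix.smul_mul]; exact S.smul_mem _ hx
  rw [eq_top_iff]
  intro M _
  rw [Matrix.matrix_eq_sum_single M]
  refine S.sum_mem fun a _ => S.sum_mem fun c _ => ?_
  obtain ⟨b⟩ := ‹Nonempty β›
  have := h1 (Matrix.single a b (M a c)) (Matrix.single b c 1)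
  simpa using this

/-- transfer of linear relations -/
theorem exists_transfer {α β α' β' I J : Type*} [Fintype α] [Fintype β]
    [DecidableEq α] [DecidableEq β] [Fintype α'] [Fintype β']
    [DecidableEq α'] [DecidableEq β']
    (P : I → Matrix α β ℂ) (Q : J → Matrix β α ℂ)
    (P' : I → Matrix α' β' ℂ) (Q' : J → Matrix β' α' ℂ)
    (hP : Submodule.span ℂ (Set.range P) = ⊤)
    (hQ' : Submodule.span ℂ (Set.range Q') = ⊤)
    (h : ∀ i j, (P i * Q j).trace = (P' i * Q' j).trace) :
    ∃ φ : Matrix α β ℂ →ₗ[ℂ] Matrix α' β' ℂ, ∀ i, φ (P i) = P' i := by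
  set f := Finsupp.linearCombination ℂ P with hf
  set f' := Finsupp.linearCombination ℂ P' with hf'
  have hsurj : LinearMap.range f = ⊤ := by rw [hf, Finsupp.range_linearCombination, hP]
  obtain ⟨g, hg⟩ := f.exists_rightInverse_of_surjective hsurj
  have hker : ∀ x, f x = 0 → f' x = 0 := by
    intro x hx
    have h1 : ∀ j, (f' x * Q' j).trace = 0 := by
      intro j
      have : (f x * Q j).trace = (f' x * Q' j).trace := by
        simp only [hf, hf', Finsupp.linearCombination_apply, Finsupp.sum, 
          Matrix.sum_mul, Matrix.trace_sum, Matrix.smul_mul, Matrix.trace_smul, h]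
      rw [← this, hx]; simp
    have h2 := inj_of_span (I := J) (fun j => Q' j) hQ'
    have h3 : (f' x)ᵀ = 0 := by
      apply h2
      funext j
      simp only [Matrix.transpose_transpose]
      rw [Matrix.trace_mul_comm, h1]; simp
    simpa using congrArg Matrix.transpose h3
  refine ⟨f' ∘ₗ g, fun i => ?_⟩
  have e1 : f (Finsupp.single i 1) = P i := by simp [hf]
  have e2 : f' (Finsupp.single i 1) = P' i := by simp [hf']
  have h4 : f (g (P i) - Finsupp.single i 1) = 0 := by
    rw [map_sub, e1]
    have := LinearMap.congr_fun hg (P i)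
    simp only [LinearMap.comp_apply, LinearMap.id_apply] at this
    rw [this, sub_self]
  have h5 := hker _ h4
  rw [map_sub, e2, sub_eq_zero] at h5
  exact h5

theorem surj_of_span {V V' I : Type*} [AddCommGroup V] [Module ℂ V] [AddCommGroup V'] [Module ℂ V']
    (φ : V →ₗ[ℂ] V') (P : I → V) (P' : I → V') (h : ∀ i, φ (P i) = P' i)
    (hP' : Submodule.span ℂ (Set.range P') = ⊤) : Function.Surjective φ := by
  rw [← LinearMap.range_eq_top, eq_top_iff, ← hP', Submodule.span_le]
  rintro _ ⟨i, rfl⟩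
  exact ⟨P i, h i⟩

theorem card_eq_of_trace {α β α' β' I J : Type*} [Fintype α] [Fintype β]
    [DecidableEq α] [DecidableEq β] [Fintype α'] [Fintype β']
    [DecidableEq α'] [DecidableEq β']
    (P : I → Matrix α β ℂ) (Q : J → Matrix β α ℂ)
    (P' : I → Matrix α' β' ℂ) (Q' : J → Matrix β' α' ℂ)
    (hP : Submodule.span ℂ (Set.range P) = ⊤)
    (hQ : Submodule.span ℂ (Set.range Q) = ⊤)
    (hP' : Submodule.span ℂ (Set.range P') = ⊤)
    (hQ' : Submodule.span ℂ (Set.range Q') = ⊤)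
    (h : ∀ i j, (P i * Q j).trace = (P' i * Q' j).trace) :
    Fintype.card α * Fintype.card β = Fintype.card α' * Fintype.card β' := by
  obtain ⟨φ, hφ⟩ := exists_transfer P Q P' Q' hP hQ' h
  obtain ⟨χ, hχ⟩ := exists_transfer P' Q' P Q hP' hQ (fun i j => (h i j).symm)
  have h1 := LinearMap.finrank_le_finrank_of_surjective (surj_of_span φ P P' hφ hP')
  have h2 := LinearMap.finrank_le_finrank_of_surjective (surj_of_span χ P' P hχ hP)
  simp only [Module.finrank_matrix, Module.finrank_self, mul_one, Fintype.card_eq_nat_card] at h1 h2 ⊢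
  omega

/-- Skolem-Noether for matrix algebras -/
theorem matrix_inner {m : ℕ} (θ : Matrix (Fin m) (Fin m) ℂ →ₗ[ℂ] Matrix (Fin m) (Fin m) ℂ)
    (h1 : θ 1 = 1) (hmul : ∀ x y, θ (x * y) = θ x * θ y) (hs : Function.Surjective θ) :
    ∃ S : (Matrix (Fin m) (Fin m) ℂ)ˣ, ∀ M, θ M = S.val * M * S.inv := by
  have hi : Function.Injective θ := LinearMap.injective_iff_surjective.2 hs
  let e : Matrix (Fin m) (Fin m) ℂ ≃ₐ[ℂ] Matrix (Fin m) (Fin m) ℂ :=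
    AlgEquiv.ofBijective (AlgHom.ofLinearMap θ h1 hmul) ⟨hi, hs⟩
  let t : Matrix (Fin m) (Fin m) ℂ ≃ₐ[ℂ] Module.End ℂ (Fin m → ℂ) := Matrix.toLinAlgEquiv'
  obtain ⟨T, hT⟩ := AlgEquiv.eq_linearEquivConjAlgEquiv ((t.symm.trans e).trans t)
  refine ⟨⟨t.symm T.toLinearMap, t.symm T.symm.toLinearMap, ?_, ?_⟩, fun M => ?_⟩
  · rw [← map_mul]
    convert map_one t.symm
    ext x; simp
  · rw [← map_mul]
    convert map_one t.symm
    ext x; simp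
  · apply t.injective
    have := AlgEquiv.congr_fun hT (t M)
    simp only [map_mul, AlgEquiv.apply_symm_apply]
    simp only [AlgEquiv.trans_apply, AlgEquiv.symm_apply_apply] at this
    change t (e M) = _
    rw [this]
    rfl

end Generic

section Phase1

theorem mprod_cons (dph : ℕ) (m : ℕ) (D : ℕ → ℕ)
    (A : ∀ k : ℕ, Fin dph → Matrix (Fin (D k)) (Fin (D (k + 1))) ℂ) (i : ℕ → Fin dph) :
    mprod D (fun _ => dph) A i 0 (m + 1) =
      A 0 (i 0) * mprod (fun k => D (k + 1)) (fun _ => dph) (fun k => A (k + 1))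
        (fun k => i (k + 1)) 0 m := by
  induction m with
  | zero =>
    change (1 : Matrix (Fin (D 0)) (Fin (D 0)) ℂ) * A 0 (i 0) =
      A 0 (i 0) * (1 : Matrix (Fin (D 1)) (Fin (D 1)) ℂ)
    rw [Matrix.one_mul, Matrix.mul_one]
  | succ m ih =>
    change mprod D (fun _ => dph) A i 0 (m + 1) * A (0 + (m + 1)) (i (0 + (m + 1))) =
      A 0 (i 0) * (mprod (fun k => D (k + 1)) (fun _ => dph) (fun k => A (k + 1))
        (fun k => i (k + 1)) 0 m * A (0 + m + 1) (i (0 + m + 1)))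
    rw [ih, Matrix.mul_assoc]
    rfl

theorem mpsCoeff_cons (dph : ℕ) (m : ℕ) (D : ℕ → ℕ)
    (A : ∀ k : ℕ, Fin dph → Matrix (Fin (D k)) (Fin (D (k + 1))) ℂ) (h : D (m + 1) = D 0)
    (h' : D 0 = D (0 + m + 1)) (i : ℕ → Fin dph) :
    mpsCoeff (m + 1) D (fun _ => dph) A h i =
      (A 0 (i 0) * (mprod (fun k => D (k + 1)) (fun _ => dph) (fun k => A (k + 1))
        (fun k => i (k + 1)) 0 m).submatrix id (Fin.cast h')).trace := by
  unfold mpsCoeff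
  rw [mprod_cons]
  rfl

theorem mpsCoeff_snoc (dph : ℕ) (m : ℕ) (D : ℕ → ℕ)
    (A : ∀ k : ℕ, Fin dph → Matrix (Fin (D k)) (Fin (D (k + 1))) ℂ) (h : D (m + 1) = D 0)
    (h' : D 0 = D (0 + m + 1)) (i : ℕ → Fin dph) :
    mpsCoeff (m + 1) D (fun _ => dph) A h i =
      (mprod D (fun _ => dph) A i 0 m *
        (A (0 + m) (i (0 + m))).submatrix id (Fin.cast h')).trace := by
  rfl

theorem range_word_cons {dph : ℕ} {T : Type*} (f : Fin dph → (ℕ → Fin dph) → T) :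
    Set.range (fun w : ℕ → Fin dph => f (w 0) (fun k => w (k + 1))) =
      Set.range (fun p : Fin dph × (ℕ → Fin dph) => f p.1 p.2) := by
  ext x
  constructor
  · rintro ⟨w, rfl⟩; exact ⟨(w 0, fun k => w (k + 1)), rfl⟩
  · rintro ⟨⟨a, w⟩, rfl⟩
    exact ⟨fun k => Nat.casesOn k a w, rfl⟩

theorem span_mprod (dph : ℕ) (m : ℕ) : ∀ (D : ℕ → ℕ) (_ : ∀ k, 0 < D k)
    (A : ∀ k : ℕ, Fin dph → Matrix (Fin (D k)) (Fin (D (k + 1))) ℂ)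
    (_ : ∀ k, Submodule.span ℂ (Set.range (A k)) = ⊤),
    Submodule.span ℂ (Set.range fun w : ℕ → Fin dph =>
      mprod D (fun _ => dph) A w 0 (m + 1)) = ⊤ := by
  induction m with
  | zero =>
    intro D hpos A hA
    have : (Set.range fun w : ℕ → Fin dph => mprod D (fun _ => dph) A w 0 (0 + 1)) =
        Set.range (A 0) := by
      have h1 : ∀ w : ℕ → Fin dph, mprod D (fun _ => dph) A w 0 (0 + 1) = A 0 (w 0) := by
        intro w
        change (1 : Matrix (Fin (D 0)) (Fin (D 0)) ℂ) * A 0 (w 0) = _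
        rw [Matrix.one_mul]
      ext x
      constructor
      · rintro ⟨w, rfl⟩; exact ⟨w 0, (h1 w).symm⟩
      · rintro ⟨a, rfl⟩; exact ⟨fun _ => a, h1 _⟩
    exact (congrArg (Submodule.span ℂ) this).trans (hA 0)
  | succ m ih =>
    intro D hpos A hA
    have hR := ih (fun k => D (k + 1)) (fun k => hpos _) (fun k => A (k + 1)) (fun k => hA _)
    have : Nonempty (Fin (D (0 + 1))) := ⟨⟨0, hpos _⟩⟩
    have := span_mul (A 0) _ (hA 0) hR
    rw [← this, ← range_word_cons (fun a w => A 0 a * mprod (fun k => D (k + 1)) (fun _ => dph)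
      (fun k => A (k + 1)) w 0 (m + 1))]
    congr 2
    funext w
    exact mprod_cons dph (m + 1) D A w

theorem span_cast {I : Type*} {a b c : ℕ} (h : c = b) (P : I → Matrix (Fin a) (Fin b) ℂ)
    (hP : Submodule.span ℂ (Set.range P) = ⊤) :
    Submodule.span ℂ (Set.range fun w => (P w).submatrix id (Fin.cast h)) = ⊤ := by
  subst h
  exact hP

/-- the hypotheses on a periodic family -/
structure Good (n dph : ℕ) (D : ℕ → ℕ)
    (A : ∀ k : ℕ, Fin dph → Matrix (Fin (D k)) (Fin (D (k + 1))) ℂ) : Prop where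
  pos : ∀ k, 0 < D k
  per : ∀ k, D (k + n) = D k
  Aper : ∀ k (h1 : D (k + n) = D k) (h2 : D (k + n + 1) = D (k + 1)) a,
    A (k + n) a = (A k a).submatrix (Fin.cast h1) (Fin.cast h2)
  span : ∀ k, Submodule.span ℂ (Set.range (A k)) = ⊤
  trans : ∀ (h1 : D n = D 0) (h2 : D (n + 1) = D 1) (i : ℕ → Fin dph),
      mpsCoeff n D (fun _ => dph) A h1 i =
      mpsCoeff n (fun k => D (k + 1)) (fun _ => dph) (fun k => A (k + 1)) h2 i

theorem trace_rot_cast {a b c e : ℕ} (h : b = c) (h' : a = e) (M : Matrix (Fin a) (Fin c) ℂ)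
    (N : Matrix (Fin b) (Fin a) ℂ) :
    (M * (N.submatrix (Fin.cast h.symm) (Fin.cast h'.symm)).submatrix id (Fin.cast h')).trace =
      (N * M.submatrix id (Fin.cast h)).trace := by
  subst h
  subst h'
  exact Matrix.trace_mul_comm M N

theorem rot (m dph : ℕ) (D : ℕ → ℕ)
    (A : ∀ k : ℕ, Fin dph → Matrix (Fin (D k)) (Fin (D (k + 1))) ℂ)
    (hA : ∀ (h1 : D (0 + (m + 1)) = D 0) (h2 : D (0 + (m + 1) + 1) = D (0 + 1)) a,
      A (0 + (m + 1)) a = (A 0 a).submatrix (Fin.cast h1) (Fin.cast h2))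
    (h1 : D (m + 1) = D 0) (h2 : D (m + 1 + 1) = D 1) (i : ℕ → Fin dph) :
    mpsCoeff (m + 1) (fun k => D (k + 1)) (fun _ => dph) (fun k => A (k + 1)) h2 i =
    mpsCoeff (m + 1) D (fun _ => dph) A h1 (fun k => Nat.casesOn k (i (0 + m)) i) := by
  have e1 : D 0 = D (0 + m + 1) := by rw [Nat.zero_add]; exact h1.symm
  have e2 : D (0 + 1) = D (0 + m + 1 + 1) := by rw [Nat.zero_add m]; exact h2.symm
  rw [mpsCoeff_cons dph m D A h1 e1, mpsCoeff_snoc dph m _ _ h2 e2]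
  have := hA e1.symm e2.symm (i (0 + m))
  change (mprod (fun k => D (k + 1)) (fun _ => dph) (fun k => A (k + 1)) i 0 m *
    (show Matrix (Fin (D (0 + m + 1))) (Fin (D (0 + m + 1 + 1))) ℂ from
      A (0 + (m + 1)) (i (0 + m))).submatrix id (Fin.cast e2)).trace = _
  rw [this]
  exact trace_rot_cast e1 e2 _ _

theorem Good.shift {n dph : ℕ} (hn : 3 ≤ n) {D : ℕ → ℕ}
    {A : ∀ k : ℕ, Fin dph → Matrix (Fin (D k)) (Fin (D (k + 1))) ℂ} (g : Good n dph D A) :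
    Good n dph (fun k => D (k + 1)) (fun k => A (k + 1)) := by
  have aper : ∀ k (h1 : D (k + n + 1) = D (k + 1)) (h2 : D (k + n + 1 + 1) = D (k + 1 + 1)) a,
    A (k + n + 1) a = (A (k + 1) a).submatrix (Fin.cast h1) (Fin.cast h2) := by
    intro k
    have := g.Aper (k + 1)
    have e : k + 1 + n = k + n + 1 := by omega
    rw [e] at this
    exact this
  refine ⟨fun k => g.pos _, fun k => ?_, fun k h1 h2 a => aper k h1 h2 a, fun k => g.span _, ?_⟩
  · have := g.per (k + 1)
    have e : k + 1 + n = k + n + 1 := by omega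
    rwa [e] at this
  · intro h1 h2 i
    obtain ⟨m, rfl⟩ : ∃ m, n = m + 1 := ⟨n - 1, by omega⟩
    have h0 : D (m + 1) = D 0 := by simpa using g.per 0
    rw [rot m dph D A (g.Aper 0) h0 h1, g.trans h0 h1,
      rot m dph (fun k => D (k + 1)) (fun k => A (k + 1)) (aper 0) h1 h2]

/-- data at position zero, block length one -/
theorem Good.block1 {n dph : ℕ} (hn : 3 ≤ n) {D : ℕ → ℕ}
    {A : ∀ k : ℕ, Fin dph → Matrix (Fin (D k)) (Fin (D (k + 1))) ℂ} (g : Good n dph D A) :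
    ∃ (Q : (ℕ → Fin dph) → Matrix (Fin (D 1)) (Fin (D 0)) ℂ)
      (Q' : (ℕ → Fin dph) → Matrix (Fin (D 2)) (Fin (D 1)) ℂ),
      Submodule.span ℂ (Set.range Q) = ⊤ ∧ Submodule.span ℂ (Set.range Q') = ⊤ ∧
      ∀ a w, (A 0 a * Q w).trace = (A 1 a * Q' w).trace := by
  obtain ⟨m, rfl⟩ : ∃ m, n = m + 1 + 1 := ⟨n - 2, by omega⟩
  have h1 : D (m + 1 + 1) = D 0 := by simpa using g.per 0
  have h2 : D (m + 1 + 1 + 1) = D 1 := by simpa using (g.shift hn).per 0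
  have e1 : D 0 = D (0 + (m + 1) + 1) := by rw [Nat.zero_add]; exact h1.symm
  have e2 : D (0 + 1) = D (0 + (m + 1) + 1 + 1) := by rw [Nat.zero_add (m + 1)]; exact h2.symm
  refine ⟨_, _, span_cast e1 _ (span_mprod dph m (fun k => D (k + 1)) (fun k => g.pos _)
      (fun k => A (k + 1)) (fun k => g.span _)),
      span_cast e2 _ (span_mprod dph m (fun k => D (k + 1 + 1)) (fun k => g.pos _)
      (fun k => A (k + 1 + 1)) (fun k => g.span _)), fun a w => ?_⟩
  have := g.trans h1 h2 (fun k => Nat.casesOn k a w)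
  rw [mpsCoeff_cons dph (m + 1) D A h1 e1, mpsCoeff_cons dph (m + 1) _ _ h2 e2] at this
  exact this

/-- data at position zero, block length two -/
theorem Good.block2 {n dph : ℕ} (hn : 3 ≤ n) {D : ℕ → ℕ}
    {A : ∀ k : ℕ, Fin dph → Matrix (Fin (D k)) (Fin (D (k + 1))) ℂ} (g : Good n dph D A) :
    ∃ (Q : (ℕ → Fin dph) → Matrix (Fin (D 2)) (Fin (D 0)) ℂ)
      (Q' : (ℕ → Fin dph) → Matrix (Fin (D 3)) (Fin (D 1)) ℂ),
      Submodule.span ℂ (Set.range Q) = ⊤ ∧ Submodule.span ℂ (Set.range Q') = ⊤ ∧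
      ∀ (p : Fin dph × Fin dph) w,
        ((A 0 p.1 * A 1 p.2) * Q w).trace = ((A 1 p.1 * A 2 p.2) * Q' w).trace := by
  obtain ⟨m, rfl⟩ : ∃ m, n = m + 1 + 1 + 1 := ⟨n - 3, by omega⟩
  have h1 : D (m + 1 + 1 + 1) = D 0 := by simpa using g.per 0
  have h2 : D (m + 1 + 1 + 1 + 1) = D 1 := by simpa using (g.shift hn).per 0
  have e1 : D 0 = D (0 + (m + 1) + 1 + 1) := by rw [Nat.zero_add (m + 1)]; exact h1.symm
  have e2 : D (0 + 1) = D (0 + (m + 1) + 1 + 1 + 1) := by rw [Nat.zero_add (m + 1)]; exact h2.symm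
  refine ⟨_, _, span_cast e1 _ (span_mprod dph m (fun k => D (k + 1 + 1)) (fun k => g.pos _)
      (fun k => A (k + 1 + 1)) (fun k => g.span _)),
      span_cast e2 _ (span_mprod dph m (fun k => D (k + 1 + 1 + 1)) (fun k => g.pos _)
      (fun k => A (k + 1 + 1 + 1)) (fun k => g.span _)), fun p w => ?_⟩
  have := g.trans h1 h2 (fun k => Nat.casesOn k p.1 (fun k => Nat.casesOn k p.2 w))
  rw [mpsCoeff_cons dph (m + 1 + 1) D A h1 e1, mpsCoeff_cons dph (m + 1 + 1) _ _ h2 e2,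
    mprod_cons dph (m + 1) (fun k => D (k + 1)), mprod_cons dph (m + 1) (fun k => D (k + 1 + 1))]
    at this
  rw [Matrix.mul_assoc, Matrix.mul_assoc]
  exact this

theorem Good.dims {n dph : ℕ} (hn : 3 ≤ n) (k : ℕ) : ∀ {D : ℕ → ℕ}
    {A : ∀ k : ℕ, Fin dph → Matrix (Fin (D k)) (Fin (D (k + 1))) ℂ} (_ : Good n dph D A),
    D k * D (k + 1) = D (k + 1) * D (k + 2) ∧ D k * D (k + 2) = D (k + 1) * D (k + 3) := by
  induction k with
  | zero =>
    intro D A g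
    constructor
    · obtain ⟨Q, Q', hQ, hQ', h⟩ := g.block1 hn
      simpa using card_eq_of_trace (A 0) Q (A 1) Q' (g.span 0) hQ (g.span 1) hQ' h
    · obtain ⟨Q, Q', hQ, hQ', h⟩ := g.block2 hn
      have : Nonempty (Fin (D (0 + 1))) := ⟨⟨0, g.pos _⟩⟩
      have : Nonempty (Fin (D (1 + 1))) := ⟨⟨0, g.pos _⟩⟩
      simpa using card_eq_of_trace (fun p : Fin dph × Fin dph => A 0 p.1 * A 1 p.2) Q
        (fun p : Fin dph × Fin dph => A 1 p.1 * A 2 p.2) Q'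
        (span_mul (A 0) (A 1) (g.span 0) (g.span 1)) hQ
        (span_mul (A 1) (A 2) (g.span 1) (g.span 2)) hQ' h
  | succ k ih =>
    intro D A g
    exact ih (g.shift hn)

theorem Good.dim_eq {n dph : ℕ} (hn : 3 ≤ n) {D : ℕ → ℕ}
    {A : ∀ k : ℕ, Fin dph → Matrix (Fin (D k)) (Fin (D (k + 1))) ℂ} (g : Good n dph D A) (k : ℕ) :
    D k = D 0 := by
  have h2 : ∀ k, D (k + 2) = D k := by
    intro k
    have h := (g.dims hn k).1
    have := g.pos (k + 1)
    rw [mul_comm] at h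
    exact (Nat.eq_of_mul_eq_mul_left this h).symm
  have h1 : ∀ k, D (k + 1) = D k := by
    intro k
    have h := (g.dims hn k).2
    have e : D (k + 3) = D (k + 1) := h2 (k + 1)
    rw [h2, e] at h
    exact (Nat.mul_self_inj.1 h).symm
  induction k with
  | zero => rfl
  | succ k ih => rw [h1, ih]

end Phase1

section Phase2

theorem Good.phi {n dph m : ℕ} (hn : 3 ≤ n) (k : ℕ) :
    ∀ {C : ℕ → Fin dph → Matrix (Fin m) (Fin m) ℂ} (_ : Good n dph (fun _ => m) C),
    ∃ φ : Matrix (Fin m) (Fin m) ℂ →ₗ[ℂ] Matrix (Fin m) (Fin m) ℂ,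
      ∀ a, φ (C k a) = C (k + 1) a := by
  induction k with
  | zero =>
    intro C g
    obtain ⟨Q, Q', hQ, hQ', h⟩ := g.block1 hn
    exact exists_transfer (C 0) Q (C 1) Q' (g.span 0) hQ' h
  | succ k ih =>
    intro C g
    exact ih (g.shift hn)

theorem Good.phi2 {n dph m : ℕ} (hn : 3 ≤ n) (k : ℕ) :
    ∀ {C : ℕ → Fin dph → Matrix (Fin m) (Fin m) ℂ} (_ : Good n dph (fun _ => m) C),
    ∃ φ : Matrix (Fin m) (Fin m) ℂ →ₗ[ℂ] Matrix (Fin m) (Fin m) ℂ,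
      ∀ a b, φ (C k a * C (k + 1) b) = C (k + 1) a * C (k + 2) b := by
  induction k with
  | zero =>
    intro C g
    obtain ⟨Q, Q', hQ, hQ', h⟩ := g.block2 hn
    have : Nonempty (Fin m) := ⟨⟨0, g.pos 0⟩⟩
    obtain ⟨φ, hφ⟩ := exists_transfer (fun p : Fin dph × Fin dph => C 0 p.1 * C 1 p.2) Q
        (fun p : Fin dph × Fin dph => C 1 p.1 * C 2 p.2) Q'
        (span_mul (C 0) (C 1) (g.span 0) (g.span 1)) hQ' h
    exact ⟨φ, fun a b => hφ (a, b)⟩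
  | succ k ih =>
    intro C g
    exact ih (g.shift hn)

theorem span_ext2 {m : ℕ} {I J : Type*} (P : I → Matrix (Fin m) (Fin m) ℂ)
    (Q : J → Matrix (Fin m) (Fin m) ℂ)
    (hP : Submodule.span ℂ (Set.range P) = ⊤) (hQ : Submodule.span ℂ (Set.range Q) = ⊤)
    (f g F : Matrix (Fin m) (Fin m) ℂ →ₗ[ℂ] Matrix (Fin m) (Fin m) ℂ)
    (h : ∀ i j, f (P i) * g (Q j) = F (P i * Q j)) (M N) : f M * g N = F (M * N) := by
  have hM : M ∈ Submodule.span ℂ (Set.range P) := by rw [hP]; trivial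
  have hN : N ∈ Submodule.span ℂ (Set.range Q) := by rw [hQ]; trivial
  induction hM using Submodule.span_induction with
  | mem x hx =>
    obtain ⟨i, rfl⟩ := hx
    induction hN using Submodule.span_induction with
    | mem y hy => obtain ⟨j, rfl⟩ := hy; exact h i j
    | zero => simp
    | add x y _ _ hx hy => simp [mul_add, hx, hy]
    | smul a x _ hx => simp [hx]
  | zero => simp
  | add x y _ _ hx hy => simp [add_mul, hx, hy]
  | smul a x _ hx => simp [hx]

theorem mps_gauge {m : ℕ} (φ Φ : ℕ → Matrix (Fin m) (Fin m) ℂ →ₗ[ℂ] Matrix (Fin m) (Fin m) ℂ)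
    (hs : ∀ k, Function.Surjective (φ k))
    (h : ∀ k M N, φ k M * φ (k + 1) N = Φ k (M * N)) :
    ∃ Z : ℕ → (Matrix (Fin m) (Fin m) ℂ)ˣ, ∀ k M,
      φ k M = (Z k)⁻¹.val * M * (Z (k + 1)).val := by
  have hsw : ∀ k M N, φ k M * φ (k + 1) N = φ k (M * N) * φ (k + 1) 1 := by
    intro k M N; rw [h, h, mul_one]
  have hsw' : ∀ k M N, φ k M * φ (k + 1) N = φ k 1 * φ (k + 1) (M * N) := by
    intro k M N; rw [h, h, one_mul]
  have hu : ∀ k, IsUnit (φ k 1) := by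
    intro k
    obtain ⟨M, hM⟩ := hs k 1
    obtain ⟨N, hN⟩ := hs (k + 1) 1
    have := hsw' k M N
    rw [hM, hN, one_mul] at this
    exact (Matrix.isUnit_iff_isUnit_det _).2 (Matrix.isUnit_det_of_right_inverse this.symm)
  choose u hu using hu
  have h3 : ∀ k M, φ (k + 1) M = (u k)⁻¹.val * φ k M * (u (k + 1)).val := by
    intro k M
    have := hsw k 1 M
    rw [one_mul, ← hu, ← hu] at this
    rw [mul_assoc, ← this, Units.inv_mul_cancel_left]
  have h4 : ∀ M N, φ 0 (M * N) = φ 0 M * (u 0)⁻¹.val * φ 0 N := by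
    intro M N
    have := hsw 0 M N
    rw [h3, ← hu, ← mul_assoc] at this
    have := (u (0 + 1)).isUnit.mul_left_injective this
    rw [← this, mul_assoc]
  obtain ⟨S, hS⟩ := matrix_inner ((LinearMap.mulRight ℂ (u 0)⁻¹.val) ∘ₗ φ 0)
    (by simp [← hu]) (by intro x y; simp [h4, mul_assoc])
    (by
      intro y
      obtain ⟨x, hx⟩ := hs 0 (y * (u 0).val)
      exact ⟨x, by simp [hx]⟩)
  have h5 : ∀ M, φ 0 M = S.val * M * S.inv * (u 0).val := by
    intro M
    rw [← hS]; simp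
  let Z : ℕ → (Matrix (Fin m) (Fin m) ℂ)ˣ := fun k => Nat.rec S⁻¹ (fun k z => z * u k) k
  have Z0 : Z 0 = S⁻¹ := rfl
  have Zs : ∀ k, Z (k + 1) = Z k * u k := fun k => rfl
  refine ⟨Z, fun k => ?_⟩
  induction k with
  | zero =>
    intro M
    rw [h5, Zs, Z0]
    simp [mul_assoc, -Matrix.coe_units_inv]
  | succ k ih =>
    intro M
    rw [h3, ih, Zs (k + 1), Zs k]
    simp [mul_assoc, -Matrix.coe_units_inv]

theorem const_case {n dph m : ℕ} (hn : 3 ≤ n)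
    (C : ℕ → Fin dph → Matrix (Fin m) (Fin m) ℂ) (g : Good n dph (fun _ => m) C) :
    ∃ B : Fin dph → Matrix (Fin m) (Fin m) ℂ,
      (Function.Injective fun X : Matrix (Fin m) (Fin m) ℂ =>
        fun i : Fin dph => (B i * Xᵀ).trace) ∧
      ∀ i : ℕ → Fin dph,
        mpsCoeff n (fun _ => m) (fun _ => dph) C rfl i =
          ((List.ofFn fun k : Fin n => B (i k.val)).prod).trace := by
  have hC : ∀ k, Submodule.span ℂ (Set.range (C k)) = ⊤ := g.span
  have hper : ∀ a, C n a = C 0 a := by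
    intro a
    have := g.Aper 0 rfl rfl a
    rw [Nat.zero_add] at this
    exact this
  choose φ hφ using fun k => Good.phi hn k g
  choose Φ hΦ using fun k => Good.phi2 hn k g
  obtain ⟨Z, hZ⟩ := mps_gauge φ Φ (fun k => surj_of_span (φ k) (C k) (C (k + 1)) (hφ k) (hC _))
    (fun k => span_ext2 (C k) (C (k + 1)) (hC _) (hC _) _ _ _
      (fun i j => by rw [hφ, hφ, hΦ]))
  let W : ℕ → (Matrix (Fin m) (Fin m) ℂ)ˣ := fun k => Nat.rec 1 (fun k w => w * Z k) k
  have W0 : W 0 = 1 := rfl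
  have Ws : ∀ k, W (k + 1) = W k * Z k := fun k => rfl
  clear_value W
  let B : Fin dph → Matrix (Fin m) (Fin m) ℂ := fun a => C 0 a * (Z 0)⁻¹.val
  have hB : ∀ k a, C k a = (W k)⁻¹.val * B a * (W (k + 1)).val := by
    intro k a
    induction k with
    | zero => rw [Ws, W0]; simp [B]
    | succ k ih =>
      rw [← hφ, hZ, ih, Ws (k + 1), Ws k]
      simp [mul_assoc, -Matrix.coe_units_inv]
  have spanB : Submodule.span ℂ (Set.range B) = ⊤ := by
    rw [eq_top_iff]
    intro M _
    have : M * (Z 0).val ∈ Submodule.span ℂ (Set.range (C 0)) := by rw [hC]; trivial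
    have := Submodule.mem_map_of_mem (f := LinearMap.mulRight ℂ (Z 0)⁻¹.val) this
    rw [Submodule.map_span, ← Set.range_comp] at this
    rw [LinearMap.mulRight_apply, Units.mul_inv_cancel_right] at this
    exact this
  -- W n is central
  have hcomm : ∀ M, (W n)⁻¹.val * M * (W (n + 1)).val = M * (W 1).val := by
    intro M
    have hM : M ∈ Submodule.span ℂ (Set.range B) := by rw [spanB]; trivial
    induction hM using Submodule.span_induction with
    | mem x hx =>
      obtain ⟨a, rfl⟩ := hx
      rw [← hB, hper, hB, W0]; simp
    | zero => simp
    | add x y _ _ hx hy => simp only [mul_add, add_mul, hx, hy]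
    | smul a x _ hx => simp only [Matrix.mul_smul, Matrix.smul_mul, hx]
  have hW1 : W (n + 1) = W n * W 1 := by
    have := hcomm 1
    rw [mul_one, one_mul] at this
    ext1
    rw [Units.val_mul, ← this, Units.mul_inv_cancel_left]
  have hcen : ∀ M : Matrix (Fin m) (Fin m) ℂ, M * (W n).val = (W n).val * M := by
    intro M
    have := hcomm M
    rw [hW1, Units.val_mul, ← mul_assoc] at this
    have := (W 1).isUnit.mul_left_injective this
    calc M * (W n).val = (W n).val * ((W n)⁻¹.val * M * (W n).val) := by simp [mul_assoc, -Matrix.coe_units_inv]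
      _ = (W n).val * M := by rw [this]
  obtain ⟨c, hc⟩ : ∃ c : ℂ, (W n).val = c • (1 : Matrix (Fin m) (Fin m) ℂ) := by
    have : (W n).val ∈ Subalgebra.center ℂ (Matrix (Fin m) (Fin m) ℂ) :=
      Subalgebra.mem_center_iff.2 hcen
    rw [Algebra.IsCentral.center_eq_bot, Algebra.mem_bot] at this
    obtain ⟨c, hc⟩ := this
    exact ⟨c, by rw [← hc, Algebra.algebraMap_eq_smul_one]⟩
  have hm : 0 < m := g.pos 0
  have hc0 : c ≠ 0 := by
    rintro rfl
    have : Nonempty (Fin m) := ⟨⟨0, hm⟩⟩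
    rw [zero_smul] at hc
    exact (W n).ne_zero hc
  obtain ⟨z, hz⟩ := IsAlgClosed.exists_pow_nat_eq c (n := n) (by omega)
  have hz0 : z ≠ 0 := by
    rintro rfl
    rw [zero_pow (by omega)] at hz
    exact hc0 hz.symm
  refine ⟨fun a => z • B a, ?_, ?_⟩
  · apply inj_of_span
    rw [eq_top_iff, ← spanB, Submodule.span_le]
    rintro _ ⟨a, rfl⟩
    have := Submodule.smul_mem _ z⁻¹ (Submodule.subset_span (R := ℂ)
      (Set.mem_range_self (f := fun a => z • B a) a))
    simpa [smul_smul, hz0] using this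
  · intro i
    have key : ∀ k, z ^ k • mprod (fun _ => m) (fun _ => dph) C i 0 k =
        ((List.ofFn fun j : Fin k => z • B (i j.val)).prod * (W k).val :
          Matrix (Fin m) (Fin m) ℂ) := by
      intro k
      induction k with
      | zero =>
        simp only [List.ofFn_zero, List.prod_nil, W0, pow_zero, one_smul, Units.val_one, one_mul]
        rfl
      | succ k ih =>
        rw [List.ofFn_succ', List.concat_eq_append, List.prod_append]
        change z ^ (k + 1) • (mprod (fun _ => m) (fun _ => dph) C i 0 k *
          C (0 + k) (i (0 + k))) = _
        rw [pow_succ', mul_smul, ← Matrix.smul_mul]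
        erw [ih]
        rw [Nat.zero_add, hB]
        simp [mul_assoc, -Matrix.coe_units_inv]
    have hk := key n
    rw [hz, hc, Matrix.mul_smul, mul_one] at hk
    have hk' : mprod (fun _ => m) (fun _ => dph) C i 0 n =
        (List.ofFn fun j : Fin n => z • B (i j.val)).prod := smul_right_injective _ hc0 hk
    rw [← hk']
    rfl

end Phase2

theorem good_case {n dph : ℕ} (hn : 3 ≤ n) (D : ℕ → ℕ) (hDn : D n = D 0)
    (A : ∀ k : ℕ, Fin dph → Matrix (Fin (D k)) (Fin (D (k + 1))) ℂ) (g : Good n dph D A) :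
    ∃ B : Fin dph → Matrix (Fin (D 0)) (Fin (D 0)) ℂ,
      (Function.Injective fun X : Matrix (Fin (D 0)) (Fin (D 0)) ℂ =>
        fun i : Fin dph => (B i * Xᵀ).trace) ∧
      ∀ i : ℕ → Fin dph,
        mpsCoeff n D (fun _ => dph) A hDn i =
          ((List.ofFn fun k : Fin n => B (i k.val)).prod).trace := by
  obtain ⟨m, hm⟩ : ∃ m, D = fun _ => m := ⟨D 0, funext fun k => g.dim_eq hn k⟩
  subst hm
  exact const_case hn A g

theorem cast_congr {dph : ℕ} (D : ℕ → ℕ)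
    (A : ∀ k : ℕ, Fin dph → Matrix (Fin (D k)) (Fin (D (k + 1))) ℂ) {p q a b : ℕ} (e : p = q)
    (h1 : a = D p) (h2 : b = D (p + 1)) (h3 : a = D q) (h4 : b = D (q + 1)) (x : Fin dph) :
    (A p x).submatrix (Fin.cast h1) (Fin.cast h2) =
      (A q x).submatrix (Fin.cast h3) (Fin.cast h4) := by
  subst e
  rfl

theorem span_cast2 {I : Type*} {a b c e : ℕ} (h : c = b) (h' : e = a)
    (P : I → Matrix (Fin a) (Fin b) ℂ)
    (hP : Submodule.span ℂ (Set.range P) = ⊤) :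
    Submodule.span ℂ (Set.range fun w => (P w).submatrix (Fin.cast h') (Fin.cast h)) = ⊤ := by
  subst h
  subst h'
  exact hP

theorem mprod_congr (dph : ℕ) (D : ℕ → ℕ)
    (A A' : ∀ k : ℕ, Fin dph → Matrix (Fin (D k)) (Fin (D (k + 1))) ℂ) (i : ℕ → Fin dph) (m : ℕ)
    (h : ∀ k < m, A k = A' k) :
    mprod D (fun _ => dph) A i 0 m = mprod D (fun _ => dph) A' i 0 m := by
  induction m with
  | zero => rfl
  | succ m ih =>
    change _ * A (0 + m) _ = _ * A' (0 + m) _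
    rw [ih (fun k hk => h k (by omega)), h (0 + m) (by omega)]

theorem mpsCoeff_congr (dph : ℕ) (D : ℕ → ℕ)
    (A A' : ∀ k : ℕ, Fin dph → Matrix (Fin (D k)) (Fin (D (k + 1))) ℂ) (i : ℕ → Fin dph) (m : ℕ)
    (hD : D m = D 0) (h : ∀ k < m, A k = A' k) :
    mpsCoeff m D (fun _ => dph) A hD i = mpsCoeff m D (fun _ => dph) A' hD i := by
  unfold mpsCoeff
  have hprod := mprod_congr dph D A A' i m h
  rw [hprod]

/-- an injective MPS whose state is translationally invariant has equal
bond dimensions everywhere and admits a translationally invariant injective MPS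
description with the same bond dimension. -/
theorem TI_state_has_TI_injective_MPS_description (n : ℕ) (hn : 3 ≤ n) (dph : ℕ)
    (D : ℕ → ℕ) (hpos : ∀ k, 0 < D k) (hDper : ∀ k, D (k + n) = D k)
    (hDn : D n = D 0) (hDn1 : D (n + 1) = D 1)
    (A : ∀ k : ℕ, Fin dph → Matrix (Fin (D k)) (Fin (D (k + 1))) ℂ)
    (hAn : ∀ i : Fin dph, A n i = (A 0 i).submatrix (Fin.cast hDn) (Fin.cast hDn1))
    (hinj : ∀ k < n, Function.Injective fun X : Matrix (Fin (D k)) (Fin (D (k + 1))) ℂ =>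
      fun i : Fin dph => (A k i * Xᵀ).trace)
    (htrans : ∀ i : ℕ → Fin dph,
      mpsCoeff n D (fun _ => dph) A hDn i =
      mpsCoeff n (fun k => D (k + 1)) (fun _ => dph) (fun k => A (k + 1)) hDn1 i) :
    (∀ k, D k = D 0) ∧
    ∃ B : Fin dph → Matrix (Fin (D 0)) (Fin (D 0)) ℂ,
      (Function.Injective fun X : Matrix (Fin (D 0)) (Fin (D 0)) ℂ =>
        fun i : Fin dph => (B i * Xᵀ).trace) ∧
      ∀ i : ℕ → Fin dph,
        mpsCoeff n D (fun _ => dph) A hDn i =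
          ((List.ofFn fun k : Fin n => B (i k.val)).prod).trace := by
  have hmod : ∀ k, D k = D (k % n) := by
    intro k
    have : ∀ q r, D (r + n * q) = D r := by
      intro q r
      induction q with
      | zero => simp
      | succ q ih => rw [Nat.mul_succ, ← Nat.add_assoc, hDper, ih]
    conv_lhs => rw [← Nat.mod_add_div k n]
    exact this _ _
  have hmod1 : ∀ k, D (k + 1) = D (k % n + 1) := by
    intro k
    rw [hmod (k + 1), hmod (k % n + 1)]
    congr 1
    simp [Nat.add_mod]
  let A' : ∀ k : ℕ, Fin dph → Matrix (Fin (D k)) (Fin (D (k + 1))) ℂ := fun k a =>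
    (A (k % n) a).submatrix (Fin.cast (hmod k)) (Fin.cast (hmod1 k))
  have hlt : ∀ k < n, A k = A' k := by
    intro k hk
    funext a
    exact cast_congr D A (Nat.mod_eq_of_lt hk).symm rfl rfl (hmod k) (hmod1 k) a
  have hle : ∀ k < n, A (k + 1) = A' (k + 1) := by
    intro k hk
    by_cases h : k + 1 < n
    · exact hlt _ h
    · have e : k + 1 = n := by omega
      have hn' : A n = A' n := by
        funext a
        rw [hAn]
        exact cast_congr D A (Nat.mod_self n).symm _ _ (hmod n) (hmod1 n) a
      rw [e]
      exact hn'
  have g : Good n dph D A' := by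
    refine ⟨hpos, hDper, ?_, ?_, ?_⟩
    · intro k h1 h2 a
      exact cast_congr D A (Nat.add_mod_right k n) _ _ (h1.trans (hmod k)) (h2.trans (hmod1 k)) a
    · intro k
      exact span_cast2 _ _ _ (span_of_inj (A (k % n)) (hinj _ (Nat.mod_lt _ (by omega))))
    · intro h1 h2 i
      rw [← mpsCoeff_congr dph D A A' i n h1 hlt]
      have := mpsCoeff_congr dph (fun k => D (k + 1)) (fun k => A (k + 1)) (fun k => A' (k + 1))
        i n h2 hle
      rw [← this]
      exact htrans i
  refine ⟨fun k => g.dim_eq hn k, ?_⟩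
  obtain ⟨B, hB, h⟩ := good_case hn D hDn A' g
  exact ⟨B, hB, fun i => by rw [← h, mpsCoeff_congr dph D A A' i n hDn hlt]⟩
end

section
/- Fundamental Theorem for non-translationally-invariant normal MPS: Let {A_k} and {B_k} (k = 1,…,n, n ≥ 3L) be MPS tensors such that every block of L consecutive tensors (of either family) is injective. If they generate the same state ∑Tr(A₁^{i₁}⋯A_n^{i_n})|i₁…i_n⟩ = ∑Tr(B₁^{i₁}⋯B_n^{i_n})|i₁…i_n⟩, then there exist invertible matrices Z₁,…,Z_n (cyclic, Z_{n+1}=Z₁), unique up to multiplicative constants, with B_k^i = Z_k⁻¹ A_k^i Z_{k+1} for all k, i. -/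
open Matrix

/-- Segment product from site `a` to site `b` (excluded). -/
noncomputable def segP {D d : ℕ → ℕ}
    (A : ∀ k, Fin (d k) → Matrix (Fin (D k)) (Fin (D (k + 1))) ℂ)
    (i : ∀ k, Fin (d k)) (a : ℕ) : (b : ℕ) → Matrix (Fin (D a)) (Fin (D b)) ℂ
  | 0 => if h : a = 0 then h ▸ (1 : Matrix (Fin (D a)) (Fin (D a)) ℂ) else 0
  | b + 1 => if h : a = b + 1 then h ▸ (1 : Matrix (Fin (D a)) (Fin (D a)) ℂ)
      else segP A i a b * A b (i b)

/-- The identification matrix. -/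
def JJ (p q : ℕ) : Matrix (Fin p) (Fin q) ℂ := fun x y => if (x : ℕ) = y then 1 else 0

lemma JJ_self (p : ℕ) : JJ p p = 1 := by
  ext x y
  simp [JJ, Matrix.one_apply, Fin.ext_iff]

lemma JJ_mul {p q : ℕ} (h : p = q) : JJ p q * JJ q p = 1 := by
  subst h; simp [JJ_self]

lemma submatrix_cast {p q r s : ℕ} (h : p = q) (h' : r = s) (M : Matrix (Fin q) (Fin s) ℂ) :
    M.submatrix (Fin.cast h) (Fin.cast h') = JJ p q * M * JJ s r := by
  subst h h'; simp [JJ_self]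

section seg
variable {D d : ℕ → ℕ} (A : ∀ k, Fin (d k) → Matrix (Fin (D k)) (Fin (D (k + 1))) ℂ)

lemma segP_self (i : ∀ k, Fin (d k)) (a : ℕ) : segP A i a a = 1 := by
  cases a <;> simp [segP]

lemma segP_succ (i : ∀ k, Fin (d k)) {a b : ℕ} (h : a ≤ b) :
    segP A i a (b + 1) = segP A i a b * A b (i b) := by
  have : a ≠ b + 1 := by omega
  simp [segP, this]

lemma segP_one (i : ∀ k, Fin (d k)) (a : ℕ) : segP A i a (a + 1) = A a (i a) := by
  rw [segP_succ A i le_rfl, segP_self, Matrix.one_mul]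

lemma segP_mprod (i : ∀ k, Fin (d k)) (a m : ℕ) : mprod D d A i a m = segP A i a (a + m) := by
  induction m with
  | zero => simp [mprod, segP_self]
  | succ m ih =>
    rw [mprod, ih]
    exact (segP_succ A i (Nat.le_add_right a m)).symm

lemma segP_mul (i : ∀ k, Fin (d k)) {a b c : ℕ} (h : a ≤ b) (h' : b ≤ c) :
    segP A i a b * segP A i b c = segP A i a c := by
  induction c, h' using Nat.le_induction with
  | base => simp [segP_self]
  | succ c hc ih => rw [segP_succ A i hc, segP_succ A i (h.trans hc), ← Matrix.mul_assoc, ih]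

lemma segP_congr (i j : ∀ k, Fin (d k)) {a b : ℕ} (h : a ≤ b)
    (hij : ∀ k, a ≤ k → k < b → i k = j k) : segP A i a b = segP A j a b := by
  induction b, h using Nat.le_induction with
  | base => simp [segP_self]
  | succ c hc ih =>
    rw [segP_succ A i hc, segP_succ A j hc, ih (fun k h1 h2 => hij k h1 (by omega)),
      hij c hc (by omega)]

/-- Glue two configurations at `b`. -/
def glue (i j : ∀ k, Fin (d k)) (b : ℕ) : ∀ k, Fin (d k) := fun k => if k < b then i k else j k

lemma segP_glue (i j : ∀ k, Fin (d k)) {a b c : ℕ} (h : a ≤ b) (h' : b ≤ c) :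
    segP A (glue i j b) a c = segP A i a b * segP A j b c := by
  rw [← segP_mul A _ h h', segP_congr A (glue i j b) i h, segP_congr A (glue i j b) j h']
  · intro k h1 h2; simp [glue, h1]
  · intro k h1 h2; simp [glue, h2]

/-- Injectivity of a segment. -/
def segInj (a b : ℕ) : Prop := ∀ X : Matrix (Fin (D b)) (Fin (D a)) ℂ,
  (∀ i, (segP A i a b * X).trace = 0) → X = 0

lemma segInj_of_blockInj {a L : ℕ} (h : blockInj D d A a L) : segInj A a (a + L) := by
  intro X hX
  have := @h Xᵀ 0 (by
    funext i
    simp only [segP_mprod]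
    simpa using hX i)
  simpa using this

lemma trace_eq_zero_all {p q : ℕ} (X : Matrix (Fin p) (Fin q) ℂ)
    (h : ∀ Y : Matrix (Fin q) (Fin p) ℂ, (Y * X).trace = 0) : X = 0 := by
  ext x y
  have := h (Matrix.single y x 1)
  simpa [Matrix.trace_single_mul] using this

lemma eq_zero_of_mul_right {p q r : ℕ} (hr : 0 < r) (X : Matrix (Fin p) (Fin q) ℂ)
    (h : ∀ Y : Matrix (Fin q) (Fin r) ℂ, X * Y = 0) : X = 0 := by
  ext x y
  have := congrFun (congrFun (h (Matrix.single y ⟨0, hr⟩ 1)) x) ⟨0, hr⟩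
  simpa using this

lemma eq_zero_of_mul_left {p q r : ℕ} (hr : 0 < r) (X : Matrix (Fin p) (Fin q) ℂ)
    (h : ∀ Y : Matrix (Fin r) (Fin p) ℂ, Y * X = 0) : X = 0 := by
  ext x y
  have := congrFun (congrFun (h (Matrix.single ⟨0, hr⟩ x 1)) ⟨0, hr⟩) y
  simpa using this

lemma segInj_span {a b : ℕ} (h : segInj A a b) :
    Submodule.span ℂ (Set.range fun i => segP A i a b) = ⊤ := by
  by_contra hne
  obtain ⟨f, hf, hle⟩ := Submodule.exists_le_ker_of_lt_top _ (lt_top_iff_ne_top.mpr hne)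
  apply hf
  have hrep : ∀ M, f M = (M * Matrix.of (fun y x => f (Matrix.single x y 1))).trace := by
    intro M
    conv_lhs => rw [Matrix.matrix_eq_sum_single M]
    simp only [map_sum, Matrix.trace, Matrix.diag, Matrix.mul_apply, Matrix.of_apply]
    refine Finset.sum_congr rfl fun x _ => Finset.sum_congr rfl fun y _ => ?_
    rw [← smul_eq_mul, ← map_smul, Matrix.smul_single]
    simp
  have hz := h _ (fun i => by
    rw [← hrep]
    exact hle (Submodule.subset_span ⟨i, rfl⟩))
  ext1 M
  rw [hrep, hz]; simp

/-- Extensionality on a spanning segment. -/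
lemma seg_ext {a b : ℕ} (h : segInj A a b) {V : Type*} [AddCommGroup V] [Module ℂ V]
    (f g : Matrix (Fin (D a)) (Fin (D b)) ℂ →ₗ[ℂ] V)
    (hfg : ∀ i, f (segP A i a b) = g (segP A i a b)) (M) : f M = g M := by
  have : f = g := LinearMap.ext_on (segInj_span A h) (by rintro _ ⟨i, rfl⟩; exact hfg i)
  rw [this]

lemma segInj_succ {a b : ℕ} (hp : 0 < D (a + 1)) (hab : a < b) (h : segInj A a b) (h' : segInj A (a + 1) (b + 1)) :
    segInj A a (b + 1) := by
  intro X hX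
  have h0 : ∀ j, A b j * X = 0 := by
    intro j
    apply h
    intro i
    have := hX (Function.update i b j)
    rw [segP_succ A _ hab.le, segP_congr A _ i hab.le, Function.update_self,
      Matrix.mul_assoc] at this
    · exact this
    · intro k h1 h2
      rw [Function.update_of_ne (by omega)]
  have h1 : ∀ i, segP A i (a + 1) (b + 1) * X = 0 := by
    intro i
    rw [segP_succ A i hab, Matrix.mul_assoc, h0, Matrix.mul_zero]
  apply eq_zero_of_mul_right hp
  intro Y
  apply h'
  intro i
  rw [← Matrix.mul_assoc, h1, Matrix.zero_mul, Matrix.trace_zero]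

lemma segInj_ge (hpos : ∀ k, 0 < D k) {L : ℕ} (hL : 1 ≤ L) (h : ∀ a, segInj A a (a + L))
    {a b : ℕ} (hab : a + L ≤ b) : segInj A a b := by
  obtain ⟨m, rfl⟩ := Nat.exists_eq_add_of_le hab
  clear hab
  induction m generalizing a with
  | zero => exact h a
  | succ m ih =>
    have h2 := ih (a := a + 1)
    rw [show a + 1 + L + m = a + L + m + 1 by omega] at h2
    exact segInj_succ A (b := a + L + m) (hpos _) (by omega) ih h2

end seg

section core

/-- A left-module endomorphism of rectangular matrices is a right multiplication. -/
lemma right_mul_of_comm {p q : ℕ} (hp : 0 < p)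
    (S : Matrix (Fin p) (Fin q) ℂ →ₗ[ℂ] Matrix (Fin p) (Fin q) ℂ)
    (hS : ∀ (Q : Matrix (Fin p) (Fin p) ℂ) M, S (Q * M) = Q * S M) :
    ∃ R : Matrix (Fin q) (Fin q) ℂ, ∀ M, S M = M * R := by
  let z : Fin p := ⟨0, hp⟩
  refine ⟨Matrix.of fun y y' => S (Matrix.single z y 1) z y', fun M => ?_⟩
  conv_lhs => rw [Matrix.matrix_eq_sum_single M]
  ext x y'
  simp only [map_sum, Matrix.sum_apply, Matrix.mul_apply, Matrix.of_apply]
  rw [Finset.sum_eq_single x]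
  · refine Finset.sum_congr rfl fun y _ => ?_
    have : Matrix.single x y (M x y) = (Matrix.single x z (M x y) : Matrix (Fin p) (Fin p) ℂ) * (Matrix.single z y 1 : Matrix (Fin p) (Fin q) ℂ) := by simp
    rw [this, hS]
    simp
  · intro x' _ hx
    refine Finset.sum_eq_zero fun y _ => ?_
    have : Matrix.single x' y (M x' y) = (Matrix.single x' z (M x' y) : Matrix (Fin p) (Fin p) ℂ) * (Matrix.single z y 1 : Matrix (Fin p) (Fin q) ℂ) := by
      simp
    rw [this, hS]
    simp [Matrix.single_mul_apply_of_ne, hx.symm]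
  · simp

/-- A bimodule endomorphism of rectangular matrices is a scalar. -/
lemma scalar_of_comm {p q : ℕ} (hp : 0 < p)
    (S : Matrix (Fin p) (Fin q) ℂ →ₗ[ℂ] Matrix (Fin p) (Fin q) ℂ)
    (hS : ∀ (Q : Matrix (Fin p) (Fin p) ℂ) M, S (Q * M) = Q * S M)
    (hS' : ∀ M (Q : Matrix (Fin q) (Fin q) ℂ), S (M * Q) = S M * Q) :
    ∃ c : ℂ, ∀ M, S M = c • M := by
  obtain ⟨R, hR⟩ := right_mul_of_comm hp S hS
  have hc : R ∈ Set.center (Matrix (Fin q) (Fin q) ℂ) := by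
    rw [Semigroup.mem_center_iff]
    intro Q
    rw [← sub_eq_zero]
    apply eq_zero_of_mul_left hp
    intro Y
    have := hS' Y Q
    rw [hR, hR] at this
    rw [Matrix.mul_sub, ← Matrix.mul_assoc, ← Matrix.mul_assoc, this, sub_self]
  rw [Matrix.center_eq_scalar_image] at hc
  obtain ⟨c, -, rfl⟩ := hc
  refine ⟨c, fun M => ?_⟩
  rw [hR]
  ext x y
  simp [mul_comm]

lemma half_core {p q r p' q' r' : ℕ} (hp' : 0 < p') (hr' : 0 < r')
    (S : Matrix (Fin p) (Fin q) ℂ ≃ₗ[ℂ] Matrix (Fin p') (Fin q') ℂ)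
    (T : Matrix (Fin q) (Fin r) ℂ ≃ₗ[ℂ] Matrix (Fin q') (Fin r') ℂ)
    (h : ∀ M (P : Matrix (Fin q) (Fin q) ℂ) N, S (M * P) * T N = S M * T (P * N)) :
    ∃ σ : Matrix (Fin q) (Fin q) ℂ → Matrix (Fin q') (Fin q') ℂ,
      (∀ M (P : Matrix (Fin q) (Fin q) ℂ), S (M * P) = S M * σ P) ∧ (∀ (P : Matrix (Fin q) (Fin q) ℂ) N, T (P * N) = σ P * T N) := by
  have h1 : ∀ P : Matrix (Fin q) (Fin q) ℂ, ∃ R : Matrix (Fin q') (Fin q') ℂ, ∀ M, S (M * P) = S M * R := by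
    intro P
    obtain ⟨R, hR⟩ := right_mul_of_comm hp'
      (S.toLinearMap ∘ₗ mulRightLinearMap _ ℂ P ∘ₗ S.symm.toLinearMap) (by
        intro Q M
        simp only [LinearMap.comp_apply, LinearEquiv.coe_coe, mulRightLinearMap_apply]
        rw [← sub_eq_zero]
        apply eq_zero_of_mul_right hr'
        intro Y
        obtain ⟨N, rfl⟩ := T.surjective Y
        rw [Matrix.sub_mul, h, Matrix.mul_assoc Q, h]
        simp [Matrix.mul_assoc])
    refine ⟨R, fun M => ?_⟩
    have := hR (S M)
    simpa using this
  choose σ hσ using h1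
  refine ⟨σ, fun M P => hσ P M, fun P N => ?_⟩
  rw [← sub_eq_zero]
  apply eq_zero_of_mul_left hp'
  intro Y
  obtain ⟨M, rfl⟩ := S.surjective Y
  rw [Matrix.mul_sub, ← h, hσ, Matrix.mul_assoc, sub_self]

lemma core {p q r p' q' r' : ℕ} (hp : 0 < p) (hr : 0 < r) (hp' : 0 < p') (hr' : 0 < r')
    (S : Matrix (Fin p) (Fin q) ℂ ≃ₗ[ℂ] Matrix (Fin p') (Fin q') ℂ)
    (T : Matrix (Fin q) (Fin r) ℂ ≃ₗ[ℂ] Matrix (Fin q') (Fin r') ℂ)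
    (U : Matrix (Fin p) (Fin r) ℂ ≃ₗ[ℂ] Matrix (Fin p') (Fin r') ℂ)
    (h : ∀ M N, U (M * N) = S M * T N) :
    ∃ (Z : Matrix (Fin q) (Fin q') ℂ) (W : Matrix (Fin q') (Fin q) ℂ),
      Z * W = 1 ∧ W * Z = 1 ∧
      (∀ M (P : Matrix (Fin q) (Fin q) ℂ), S (M * P) = S M * (W * P * Z)) ∧ (∀ (P : Matrix (Fin q) (Fin q) ℂ) N, T (P * N) = (W * P * Z) * T N) := by
  obtain ⟨σ, hσ, hσ'⟩ := half_core hp' hr' S T (by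
    intro M P N; rw [← h, ← h, Matrix.mul_assoc])
  obtain ⟨τ, hτ, hτ'⟩ := half_core hp hr S.symm T.symm (by
    intro M P N; apply U.injective; rw [h, h]; simp [Matrix.mul_assoc])
  have inj' : ∀ X Y : Matrix (Fin q') (Fin q') ℂ, (∀ M, S M * X = S M * Y) → X = Y := by
    intro X Y hXY
    rw [← sub_eq_zero]
    apply eq_zero_of_mul_left hp'
    intro M
    obtain ⟨M, rfl⟩ := S.surjective M
    rw [Matrix.mul_sub, hXY, sub_self]
  have inj : ∀ X Y : Matrix (Fin q) (Fin q) ℂ,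
      (∀ M : Matrix (Fin p) (Fin q) ℂ, M * X = M * Y) → X = Y := by
    intro X Y hXY
    rw [← sub_eq_zero]
    apply eq_zero_of_mul_left hp
    intro M
    rw [Matrix.mul_sub, hXY, sub_self]
  have hστ : ∀ X, σ (τ X) = X := by
    intro X
    apply inj'
    intro M
    rw [← hσ]
    apply S.symm.injective
    rw [hτ]; simp
  have hτσ : ∀ X, τ (σ X) = X := by
    intro X
    apply inj
    intro M
    apply S.injective
    rw [hσ, hστ, hσ]
  let e : Matrix (Fin q) (Fin q) ℂ ≃ₐ[ℂ] Matrix (Fin q') (Fin q') ℂ :=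
    AlgEquiv.ofLinearEquiv
      { toFun := σ
        invFun := τ
        left_inv := hτσ
        right_inv := hστ
        map_add' := by
          intro X Y; apply inj'; intro M
          rw [← hσ, Matrix.mul_add, Matrix.mul_add, map_add, hσ, hσ]
        map_smul' := by
          intro c X; apply inj'; intro M
          rw [← hσ, Matrix.mul_smul, map_smul, hσ]; simp }
      (by apply inj'; intro M
          change S M * σ 1 = _
          rw [← hσ]; simp)
      (by intro X Y; apply inj'; intro M
          change S M * σ (X * Y) = S M * (σ X * σ Y)
          rw [← hσ, ← Matrix.mul_assoc, ← Matrix.mul_assoc, hσ, hσ])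
  obtain ⟨t, ht⟩ := AlgEquiv.eq_linearEquivConjAlgEquiv
    ((Matrix.toLinAlgEquiv' (R := ℂ) (n := Fin q)).symm.trans
      (e.trans (Matrix.toLinAlgEquiv' (R := ℂ) (n := Fin q'))))
  have key : ∀ P, σ P = LinearMap.toMatrix' t.toLinearMap * P *
      LinearMap.toMatrix' t.symm.toLinearMap := by
    intro P
    have := AlgEquiv.congr_fun ht (Matrix.toLinAlgEquiv' P)
    have h2 := congrArg LinearMap.toMatrix' this
    simp [LinearMap.toMatrix'_comp, LinearEquiv.conjAlgEquiv_apply] at h2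
    have h3 : ∀ {m : ℕ} (X : Matrix (Fin m) (Fin m) ℂ),
        LinearMap.toMatrix' (Matrix.toLinAlgEquiv' X) = X := fun X => LinearMap.toMatrix'_toLin' X
    rw [h3, h3, ← Matrix.mul_assoc] at h2
    exact h2
  refine ⟨LinearMap.toMatrix' t.symm.toLinearMap, LinearMap.toMatrix' t.toLinearMap, ?_, ?_, ?_, ?_⟩
  · rw [← LinearMap.toMatrix'_comp]; simp
  · rw [← LinearMap.toMatrix'_comp]; simp
  · intro M P; rw [← key, hσ]
  · intro M P; rw [← key, hσ']

end core

section state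

lemma cyc_shift {D d : ℕ → ℕ} (A : ∀ k, Fin (d k) → Matrix (Fin (D k)) (Fin (D (k + 1))) ℂ)
    {n : ℕ} (hn : 1 ≤ n) (hDper : ∀ k, D (k + n) = D k) (hdper : ∀ k, d (k + n) = d k)
    (hA : ∀ k (i : Fin (d (k + n))), A (k + n) i =
      JJ (D (k + n)) (D k) * A k (Fin.cast (hdper k) i) * JJ (D (k + 1)) (D (k + n + 1)))
    (i : ∀ k, Fin (d k)) (a : ℕ) :
    (segP A i (a + 1) (a + 1 + n) * JJ (D (a + 1 + n)) (D (a + 1))).trace =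
    (segP A (Function.update i a (Fin.cast (hdper a) (i (a + n)))) a (a + n) *
      JJ (D (a + n)) (D a)).trace := by
  have h1 : D (a + 1) = D (a + n + 1) := by
    rw [Nat.add_right_comm]; exact (hDper (a + 1)).symm
  have h2 : segP A i (a + 1) (a + 1 + n) * JJ (D (a + 1 + n)) (D (a + 1)) =
      segP A i (a + 1) (a + n) * (JJ (D (a + n)) (D a) * A a (Fin.cast (hdper a) (i (a + n)))) := by
    rw [show a + 1 + n = a + n + 1 by omega, segP_succ A i (by omega), hA]
    simp only [Matrix.mul_assoc]
    rw [JJ_mul h1, Matrix.mul_one]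
  have h3 : segP A (Function.update i a (Fin.cast (hdper a) (i (a + n)))) (a + 1) (a + n) =
      segP A i (a + 1) (a + n) := by
    apply segP_congr A _ _ (show a + 1 ≤ a + n by omega)
    intro k hk _
    rw [Function.update_of_ne (by omega)]
  rw [h2, ← segP_mul A _ (show a ≤ a + 1 by omega) (show a + 1 ≤ a + n by omega), segP_one,
    Function.update_self, ← Matrix.mul_assoc, Matrix.trace_mul_comm, ← Matrix.mul_assoc,
    h3]

variable {D D' d : ℕ → ℕ}
  (A : ∀ k, Fin (d k) → Matrix (Fin (D k)) (Fin (D (k + 1))) ℂ)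
  (B : ∀ k, Fin (d k) → Matrix (Fin (D' k)) (Fin (D' (k + 1))) ℂ)

lemma ker_le {a b c : ℕ} (hab : a ≤ b) (hbc : b ≤ c)
    (X : Matrix (Fin (D c)) (Fin (D a)) ℂ)
    (Y : Matrix (Fin (D' c)) (Fin (D' a)) ℂ) (Y' : Matrix (Fin (D' a)) (Fin (D' c)) ℂ)
    (hY : Y' * Y = 1)
    (hst : ∀ i, (segP A i a c * X).trace = (segP B i a c * Y).trace)
    (hB : segInj B b c) :
    LinearMap.ker (Finsupp.linearCombination ℂ (fun i => segP A i a b)) ≤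
    LinearMap.ker (Finsupp.linearCombination ℂ (fun i => segP B i a b)) := by
  intro v hv
  rw [LinearMap.mem_ker] at hv ⊢
  have h0 : Y * Finsupp.linearCombination ℂ (fun i => segP B i a b) v = 0 := by
    apply hB
    intro j
    have h1 : ∀ i, (segP A i a b * (segP A j b c * X)).trace =
        (segP B i a b * (segP B j b c * Y)).trace := by
      intro i
      have := hst (glue i j b)
      rwa [segP_glue A i j hab hbc, segP_glue B i j hab hbc, Matrix.mul_assoc,
        Matrix.mul_assoc] at this
    rw [← Matrix.mul_assoc, Matrix.trace_mul_comm]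
    have h2 : (Finsupp.linearCombination ℂ (fun i => segP A i a b) v *
        (segP A j b c * X)).trace = 0 := by rw [hv]; simp
    rw [← h2, Finsupp.linearCombination_apply, Finsupp.linearCombination_apply, Finsupp.sum,
      Finsupp.sum, Matrix.sum_mul, Matrix.sum_mul, Matrix.trace_sum, Matrix.trace_sum]
    refine Finset.sum_congr rfl fun i _ => ?_
    rw [Matrix.smul_mul, Matrix.smul_mul, Matrix.trace_smul, Matrix.trace_smul, h1]
  rw [← Matrix.one_mul (Finsupp.linearCombination ℂ (fun i => segP B i a b) v), ← hY,
    Matrix.mul_assoc, h0, Matrix.mul_zero]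

lemma exists_T {a b : ℕ} (hA : segInj A a b) (hB : segInj B a b)
    (h1 : LinearMap.ker (Finsupp.linearCombination ℂ (fun i => segP A i a b)) =
      LinearMap.ker (Finsupp.linearCombination ℂ (fun i => segP B i a b))) :
    ∃ T : Matrix (Fin (D a)) (Fin (D b)) ℂ ≃ₗ[ℂ] Matrix (Fin (D' a)) (Fin (D' b)) ℂ,
      ∀ i, T (segP A i a b) = segP B i a b := by
  have sA : LinearMap.range (Finsupp.linearCombination ℂ (fun i => segP A i a b)) = ⊤ := by
    rw [Finsupp.range_linearCombination]; exact segInj_span A hA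
  have sB : LinearMap.range (Finsupp.linearCombination ℂ (fun i => segP B i a b)) = ⊤ := by
    rw [Finsupp.range_linearCombination]; exact segInj_span B hB
  let eA := LinearMap.quotKerEquivOfSurjective _ (LinearMap.range_eq_top.mp sA)
  let eB := LinearMap.quotKerEquivOfSurjective _ (LinearMap.range_eq_top.mp sB)
  refine ⟨eA.symm.trans ((Submodule.quotEquivOfEq _ _ h1).trans eB), fun i => ?_⟩
  have : eA.symm (segP A i a b) = Submodule.Quotient.mk (Finsupp.single i 1) := by
    rw [LinearEquiv.symm_apply_eq]
    simp [eA]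
  simp only [LinearEquiv.trans_apply, this, Submodule.quotEquivOfEq_mk]
  simp [eB]

/-- Multiplicativity of the transfer maps. -/
lemma T_mul {a b c : ℕ} (hab : a ≤ b) (hbc : b ≤ c) (hA1 : segInj A a b) (hA2 : segInj A b c)
    (S : Matrix (Fin (D a)) (Fin (D b)) ℂ →ₗ[ℂ] Matrix (Fin (D' a)) (Fin (D' b)) ℂ)
    (T : Matrix (Fin (D b)) (Fin (D c)) ℂ →ₗ[ℂ] Matrix (Fin (D' b)) (Fin (D' c)) ℂ)
    (U : Matrix (Fin (D a)) (Fin (D c)) ℂ →ₗ[ℂ] Matrix (Fin (D' a)) (Fin (D' c)) ℂ)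
    (hS : ∀ i, S (segP A i a b) = segP B i a b)
    (hT : ∀ i, T (segP A i b c) = segP B i b c)
    (hU : ∀ i, U (segP A i a c) = segP B i a c) (M N) : U (M * N) = S M * T N := by
  refine seg_ext A hA1 (U ∘ₗ mulRightLinearMap _ ℂ N) (mulRightLinearMap _ ℂ (T N) ∘ₗ S) ?_ M
  intro i
  refine seg_ext A hA2 (U ∘ₗ mulLeftLinearMap _ ℂ (segP A i a b))
    (mulLeftLinearMap _ ℂ (S (segP A i a b)) ∘ₗ T) ?_ N
  intro j
  simp only [LinearMap.comp_apply, mulLeftLinearMap_apply]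
  rw [hS, hT, ← segP_glue A i j hab hbc, hU, segP_glue B i j hab hbc]

/-- Multiplicativity with a single site on the right. -/
lemma T_mul_right {a b : ℕ} (hab : a ≤ b) (hA1 : segInj A a b)
    (S : Matrix (Fin (D a)) (Fin (D b)) ℂ →ₗ[ℂ] Matrix (Fin (D' a)) (Fin (D' b)) ℂ)
    (U : Matrix (Fin (D a)) (Fin (D (b + 1))) ℂ →ₗ[ℂ] Matrix (Fin (D' a)) (Fin (D' (b + 1))) ℂ)
    (hS : ∀ i, S (segP A i a b) = segP B i a b)
    (hU : ∀ i, U (segP A i a (b + 1)) = segP B i a (b + 1)) (M) (j : ∀ k, Fin (d k)) :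
    U (M * A b (j b)) = S M * B b (j b) := by
  refine seg_ext A hA1 (U ∘ₗ mulRightLinearMap _ ℂ _) (mulRightLinearMap _ ℂ (B b (j b)) ∘ₗ S) ?_ M
  intro i
  simp only [LinearMap.comp_apply, mulRightLinearMap_apply]
  rw [hS, ← segP_one A, ← segP_one B, ← segP_glue A i j hab (Nat.le_succ b), hU,
    segP_glue B i j hab (Nat.le_succ b)]

/-- Multiplicativity with a single site on the left. -/
lemma T_mul_left {a b : ℕ} (hab : a + 1 ≤ b) (hA1 : segInj A (a + 1) b)
    (S : Matrix (Fin (D (a + 1))) (Fin (D b)) ℂ →ₗ[ℂ] Matrix (Fin (D' (a + 1))) (Fin (D' b)) ℂ)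
    (U : Matrix (Fin (D a)) (Fin (D b)) ℂ →ₗ[ℂ] Matrix (Fin (D' a)) (Fin (D' b)) ℂ)
    (hS : ∀ i, S (segP A i (a + 1) b) = segP B i (a + 1) b)
    (hU : ∀ i, U (segP A i a b) = segP B i a b) (M) (j : ∀ k, Fin (d k)) :
    U (A a (j a) * M) = B a (j a) * S M := by
  refine seg_ext A hA1 (U ∘ₗ mulLeftLinearMap _ ℂ _) (mulLeftLinearMap _ ℂ (B a (j a)) ∘ₗ S) ?_ M
  intro i
  simp only [LinearMap.comp_apply, mulLeftLinearMap_apply]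
  rw [hS, ← segP_one A, ← segP_one B, ← segP_glue A j i (Nat.le_succ a) hab, hU,
    segP_glue B j i (Nat.le_succ a) hab]

end state

section gauge

variable {D D' d : ℕ → ℕ}
  (A : ∀ k, Fin (d k) → Matrix (Fin (D k)) (Fin (D (k + 1))) ℂ)
  (B : ∀ k, Fin (d k) → Matrix (Fin (D' k)) (Fin (D' (k + 1))) ℂ)

/-- `T` intertwines the `A` and `B` products over a segment. -/
def Intw (a b : ℕ)
    (T : Matrix (Fin (D a)) (Fin (D b)) ℂ →ₗ[ℂ] Matrix (Fin (D' a)) (Fin (D' b)) ℂ) : Prop :=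
  ∀ i, T (segP A i a b) = segP B i a b

/-- Local gauge at the cut `k`. -/
structure LocalGauge (L k : ℕ) (Z : Matrix (Fin (D k)) (Fin (D' k)) ℂ)
    (W : Matrix (Fin (D' k)) (Fin (D k)) ℂ) : Prop where
  zw : Z * W = 1
  wz : W * Z = 1
  left : ∀ a, a + L = k → ∀ T, Intw A B a k T →
    ∀ M (P : Matrix (Fin (D k)) (Fin (D k)) ℂ), T (M * P) = T M * (W * P * Z)
  right : ∀ T, Intw A B k (k + L) T →
    ∀ (P : Matrix (Fin (D k)) (Fin (D k)) ℂ) M, T (P * M) = W * P * Z * T M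

lemma segInj_ne {a b : ℕ} (ha : 0 < D a) (hb : 0 < D b) (h : segInj A a b) :
    ∃ i, segP A i a b ≠ 0 := by
  by_contra! hne
  have := h (Matrix.of fun _ _ => 1) (by intro i; rw [hne]; simp)
  have := congrFun (congrFun this ⟨0, hb⟩) ⟨0, ha⟩
  simp at this

lemma site_ne {a b : ℕ} (hab : a < b) (ha : 0 < D a) (hb : 0 < D b) (h : segInj A a b) :
    ∃ i : ∀ k, Fin (d k), A a (i a) ≠ 0 := by
  obtain ⟨i, hi⟩ := segInj_ne A ha hb h
  refine ⟨i, fun h0 => hi ?_⟩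
  rw [← segP_mul A i (show a ≤ a + 1 by omega) hab, segP_one, h0, Matrix.zero_mul]

lemma exists_localGauge {L n : ℕ} (hn : 3 * L ≤ n)
    (hpos : ∀ k, 0 < D k) (hpos' : ∀ k, 0 < D' k)
    (hAi : ∀ a b, a + L ≤ b → segInj A a b)
    (hT : ∀ a b, a + L ≤ b → b + L ≤ a + n →
      ∃ T : Matrix (Fin (D a)) (Fin (D b)) ℂ ≃ₗ[ℂ] Matrix (Fin (D' a)) (Fin (D' b)) ℂ,
      ∀ i, T (segP A i a b) = segP B i a b) (a : ℕ) :
    ∃ Z W, LocalGauge A B L (a + L) Z W := by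
  obtain ⟨S, hS⟩ := hT a (a + L) le_rfl (by omega)
  obtain ⟨T, hT'⟩ := hT (a + L) (a + L + L) le_rfl (by omega)
  obtain ⟨U, hU⟩ := hT a (a + L + L) (by omega) (by omega)
  obtain ⟨Z, W, h1, h2, h3, h4⟩ := core (hpos _) (hpos _) (hpos' _) (hpos' _) S T U
    (T_mul A B (by omega) (by omega) (hAi _ _ le_rfl) (hAi _ _ le_rfl)
      S.toLinearMap T.toLinearMap U.toLinearMap hS hT' hU)
  refine ⟨Z, W, h1, h2, ?_, ?_⟩
  · intro a' ha' R hR M P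
    obtain rfl : a' = a := by omega
    have : ∀ M, R M = S M := seg_ext A (hAi _ _ le_rfl) R S.toLinearMap
      (fun i => (hR i).trans (hS i).symm)
    rw [this, this, h3]
  · intro R hR P M
    have : ∀ M, R M = T M := seg_ext A (hAi _ _ le_rfl) R T.toLinearMap
      (fun i => (hR i).trans (hT' i).symm)
    rw [this, this, h4]

lemma scalar_form {a b : ℕ} (ha : 0 < D a)
    {Za : Matrix (Fin (D a)) (Fin (D' a)) ℂ} {Wa : Matrix (Fin (D' a)) (Fin (D a)) ℂ}
    {Zb : Matrix (Fin (D b)) (Fin (D' b)) ℂ} {Wb : Matrix (Fin (D' b)) (Fin (D b)) ℂ}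
    (h1 : Za * Wa = 1) (h2 : Wa * Za = 1) (h3 : Zb * Wb = 1) (h4 : Wb * Zb = 1)
    (T : Matrix (Fin (D a)) (Fin (D b)) ℂ →ₗ[ℂ] Matrix (Fin (D' a)) (Fin (D' b)) ℂ)
    (hl : ∀ (P : Matrix (Fin (D a)) (Fin (D a)) ℂ) M, T (P * M) = Wa * P * Za * T M)
    (hr : ∀ M (P : Matrix (Fin (D b)) (Fin (D b)) ℂ), T (M * P) = T M * (Wb * P * Zb)) :
    ∃ c : ℂ, ∀ M, T M = c • (Wa * M * Zb) := by
  obtain ⟨c, hc⟩ := scalar_of_comm ha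
    (mulLeftLinearMap _ ℂ Za ∘ₗ mulRightLinearMap _ ℂ Wb ∘ₗ T)
    (by
      intro P M
      simp only [LinearMap.comp_apply, mulLeftLinearMap_apply, mulRightLinearMap_apply]
      rw [hl]
      simp only [← Matrix.mul_assoc]
      rw [h1, Matrix.one_mul])
    (by
      intro M P
      simp only [LinearMap.comp_apply, mulLeftLinearMap_apply, mulRightLinearMap_apply]
      rw [hr]
      simp only [Matrix.mul_assoc]
      rw [h3, Matrix.mul_one])
  refine ⟨c, fun M => ?_⟩
  have := hc M
  simp only [LinearMap.comp_apply, mulLeftLinearMap_apply, mulRightLinearMap_apply] at this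
  calc T M = Wa * Za * T M * (Wb * Zb) := by rw [h2, h4, Matrix.one_mul, Matrix.mul_one]
    _ = Wa * (Za * (T M * Wb)) * Zb := by simp only [Matrix.mul_assoc]
    _ = _ := by rw [this]; simp

lemma site_gauge {L n : ℕ} (hL : 1 ≤ L) (hn : 3 * L ≤ n)
    (hpos : ∀ k, 0 < D k) (hpos' : ∀ k, 0 < D' k)
    (hAi : ∀ a b, a + L ≤ b → segInj A a b)
    (hBi : ∀ a b, a + L ≤ b → segInj B a b)
    (hT : ∀ a b, a + L ≤ b → b + L ≤ a + n →
      ∃ T : Matrix (Fin (D a)) (Fin (D b)) ℂ ≃ₗ[ℂ] Matrix (Fin (D' a)) (Fin (D' b)) ℂ,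
      ∀ i, T (segP A i a b) = segP B i a b) (a : ℕ)
    {Za Wa Zb Wb Zc Wc}
    (ga : LocalGauge A B L a Za Wa) (gb : LocalGauge A B L (a + L) Zb Wb)
    (gc : LocalGauge A B L (a + L + 1) Zc Wc) :
    ∃ μ : ℂ, ∀ i : ∀ k, Fin (d k),
      B (a + L) (i (a + L)) = μ • (Wb * A (a + L) (i (a + L)) * Zc) := by
  obtain ⟨S, hS⟩ := hT a (a + L) le_rfl (by omega)
  obtain ⟨S', hS'⟩ := hT (a + 1) (a + L + 1) (by omega) (by omega)
  obtain ⟨U, hU⟩ := hT a (a + L + 1) (by omega) (by omega)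
  obtain ⟨c, hc⟩ := scalar_form (hpos a) ga.zw ga.wz gb.zw gb.wz S.toLinearMap
    (ga.right S.toLinearMap hS) (gb.left a rfl S.toLinearMap hS)
  have hUr := T_mul_right A B (show a ≤ a + L by omega) (hAi _ _ le_rfl) S.toLinearMap
    U.toLinearMap hS hU
  have hUl := T_mul_left A B (show a + 1 ≤ a + L + 1 by omega) (hAi _ _ (by omega)) S'.toLinearMap
    U.toLinearMap hS' hU
  obtain ⟨c', hc'⟩ := scalar_form (hpos a) ga.zw ga.wz gc.zw gc.wz U.toLinearMap
    (by
      intro P M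
      refine seg_ext A (hAi a (a + L + 1) (by omega)) (U.toLinearMap ∘ₗ mulLeftLinearMap _ ℂ P)
        (mulLeftLinearMap _ ℂ (Wa * P * Za) ∘ₗ U.toLinearMap) ?_ M
      intro i
      simp only [LinearMap.comp_apply, mulLeftLinearMap_apply]
      rw [segP_succ A i (by omega), ← Matrix.mul_assoc, hUr, hUr,
        ga.right S.toLinearMap hS, Matrix.mul_assoc])
    (by
      intro M P
      refine seg_ext A (hAi a (a + L + 1) (by omega)) (U.toLinearMap ∘ₗ mulRightLinearMap _ ℂ P)
        (mulRightLinearMap _ ℂ (Wc * P * Zc) ∘ₗ U.toLinearMap) ?_ M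
      intro i
      simp only [LinearMap.comp_apply, mulRightLinearMap_apply]
      rw [← segP_mul A i (show a ≤ a + 1 by omega) (show a + 1 ≤ a + L + 1 by omega), segP_one,
        Matrix.mul_assoc, hUl, hUl,
        gc.left (a + 1) (by omega) S'.toLinearMap hS', ← Matrix.mul_assoc (B a (i a))])
  have hc0 : c ≠ 0 := by
    rintro rfl
    obtain ⟨i, hi⟩ := segInj_ne B (hpos' _) (hpos' _) (hBi a (a + L) le_rfl)
    apply hi
    rw [← hS]
    simpa using hc (segP A i a (a + L))
  refine ⟨c' / c, fun i => ?_⟩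
  have key : c' • (A (a + L) (i (a + L)) * Zc) - c • (Zb * B (a + L) (i (a + L))) = 0 := by
    apply eq_zero_of_mul_left (hpos a)
    intro M
    have h := hUr M i
    rw [hc, hc'] at h
    have h2 := congrArg (fun X => Za * X) h
    simp only [Matrix.mul_smul, Matrix.smul_mul, ← Matrix.mul_assoc, ga.zw, Matrix.one_mul] at h2
    simp only [Matrix.mul_sub, Matrix.mul_smul, ← Matrix.mul_assoc, h2, sub_self]
  rw [sub_eq_zero] at key
  have h3 := congrArg (fun X => c⁻¹ • (Wb * X)) key
  simp only [Matrix.mul_smul, ← Matrix.mul_assoc, gb.wz, Matrix.one_mul, smul_smul,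
    inv_mul_cancel₀ hc0, one_smul] at h3
  rw [← h3, div_eq_inv_mul]

lemma segP_gauge {Z : ∀ k : ℕ, Matrix (Fin (D k)) (Fin (D' k)) ℂ}
    {W : ∀ k : ℕ, Matrix (Fin (D' k)) (Fin (D k)) ℂ}
    (hZ : ∀ k, Z k * W k = 1 ∧ W k * Z k = 1)
    (hB : ∀ k i, B k i = W k * A k i * Z (k + 1)) (i : ∀ k, Fin (d k)) {a b : ℕ} (hab : a ≤ b) :
    segP B i a b = W a * segP A i a b * Z b := by
  induction b, hab using Nat.le_induction with
  | base => simp [segP_self, (hZ a).2]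
  | succ b hb ih =>
    rw [segP_succ B i hb, ih, hB, segP_succ A i hb]
    calc W a * segP A i a b * Z b * (W b * A b (i b) * Z (b + 1))
        = W a * segP A i a b * (Z b * W b) * A b (i b) * Z (b + 1) := by
          simp only [Matrix.mul_assoc]
      _ = _ := by rw [(hZ b).1, Matrix.mul_one]; simp only [Matrix.mul_assoc]

lemma gauge_unique {L : ℕ} (hL : 1 ≤ L)
    (hpos : ∀ k, 0 < D k) (hpos' : ∀ k, 0 < D' k)
    (hAi : ∀ a b, a + L ≤ b → segInj A a b)
    (hBi : ∀ a b, a + L ≤ b → segInj B a b)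
    {Z Z' : ∀ k : ℕ, Matrix (Fin (D k)) (Fin (D' k)) ℂ}
    {W W' : ∀ k : ℕ, Matrix (Fin (D' k)) (Fin (D k)) ℂ}
    (hZ : ∀ k, Z k * W k = 1 ∧ W k * Z k = 1)
    (hB : ∀ k i, B k i = W k * A k i * Z (k + 1))
    (hZ' : ∀ k, Z' k * W' k = 1 ∧ W' k * Z' k = 1)
    (hB' : ∀ k i, B k i = W' k * A k i * Z' (k + 1)) :
    ∃ c : ℂ, c ≠ 0 ∧ ∀ k, Z' k = c • Z k := by
  have h1 : ∀ a, ∃ c : ℂ, Z' a = c • Z a := by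
    intro a
    have e : ∀ M : Matrix (Fin (D a)) (Fin (D (a + L))) ℂ, W a * M * Z (a + L) = W' a * M * Z' (a + L) :=
      seg_ext A (hAi a (a + L) le_rfl)
        (mulRightLinearMap _ ℂ (Z (a + L)) ∘ₗ mulLeftLinearMap _ ℂ (W a))
        (mulRightLinearMap _ ℂ (Z' (a + L)) ∘ₗ mulLeftLinearMap _ ℂ (W' a)) (by
          intro i
          simp only [LinearMap.comp_apply, mulLeftLinearMap_apply, mulRightLinearMap_apply]
          rw [← segP_gauge A B hZ hB i (by omega), ← segP_gauge A B hZ' hB' i (by omega)])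
    have e2 : ∀ M : Matrix (Fin (D a)) (Fin (D (a + L))) ℂ, Z' a * W a * M = M * (Z' (a + L) * W (a + L)) := by
      intro M
      calc Z' a * W a * M = Z' a * W a * M * (Z (a + L) * W (a + L)) := by
            rw [(hZ _).1, Matrix.mul_one]
        _ = Z' a * (W a * M * Z (a + L)) * W (a + L) := by simp only [Matrix.mul_assoc]
        _ = Z' a * W' a * M * (Z' (a + L) * W (a + L)) := by
            rw [e]; simp only [Matrix.mul_assoc]
        _ = _ := by rw [(hZ' _).1, Matrix.one_mul]
    obtain ⟨c, hc⟩ := scalar_of_comm (hpos a)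
      (mulRightLinearMap (Fin (D a)) ℂ (Z' (a + L) * W (a + L)))
      (by intro Q M; simp [Matrix.mul_assoc])
      (by
        intro M Q
        simp only [mulRightLinearMap_apply]
        rw [← e2, ← e2, Matrix.mul_assoc (Z' a * W a)])
    have e3 : Z' a * W a - c • 1 = 0 := by
      apply eq_zero_of_mul_right (hpos (a + L))
      intro M
      have := hc M
      simp only [mulRightLinearMap_apply] at this
      rw [Matrix.sub_mul, e2, this]; simp
    refine ⟨c, ?_⟩
    rw [sub_eq_zero] at e3
    calc Z' a = Z' a * W a * Z a := by rw [Matrix.mul_assoc, (hZ a).2, Matrix.mul_one]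
      _ = _ := by rw [e3]; simp
  choose c hc using h1
  have h2 : ∀ k, c (k + 1) = c k := by
    intro k
    by_contra hne
    obtain ⟨i, hi⟩ := site_ne B (show k < k + L by omega) (hpos' _) (hpos' _) (hBi k _ le_rfl)
    apply hi
    have ha : Z k * B k (i k) = A k (i k) * Z (k + 1) := by
      rw [hB, ← Matrix.mul_assoc, ← Matrix.mul_assoc, (hZ k).1, Matrix.one_mul]
    have hb : Z' k * B k (i k) = A k (i k) * Z' (k + 1) := by
      rw [hB', ← Matrix.mul_assoc, ← Matrix.mul_assoc, (hZ' k).1, Matrix.one_mul]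
    rw [hc, hc, Matrix.smul_mul, Matrix.mul_smul, ← ha, ← sub_eq_zero, ← sub_smul,
      smul_eq_zero, sub_eq_zero] at hb
    have hb := hb.resolve_left (fun h => hne h.symm)
    calc B k (i k) = W k * (Z k * B k (i k)) := by
          rw [← Matrix.mul_assoc, (hZ k).2, Matrix.one_mul]
      _ = 0 := by rw [hb, Matrix.mul_zero]
  have h3 : ∀ k, c k = c 0 := by
    intro k
    induction k with
    | zero => rfl
    | succ k ih => rw [h2, ih]
  refine ⟨c 0, fun h0 => ?_, fun k => by rw [hc, h3]⟩
  have h4 := (hZ' 0).1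
  rw [hc, h0, zero_smul, Matrix.zero_mul] at h4
  have := congrFun (congrFun h4 ⟨0, hpos 0⟩) ⟨0, hpos 0⟩
  simp at this

end gauge

section global

variable {D D' d : ℕ → ℕ}
  (A : ∀ k, Fin (d k) → Matrix (Fin (D k)) (Fin (D (k + 1))) ℂ)
  (B : ∀ k, Fin (d k) → Matrix (Fin (D' k)) (Fin (D' (k + 1))) ℂ)

/-- Shift of a rectangular family by a period. -/
def shiftM {E F : ℕ → ℕ} (n : ℕ) (Z : ∀ k : ℕ, Matrix (Fin (E k)) (Fin (F k)) ℂ) (k : ℕ) :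
    Matrix (Fin (E k)) (Fin (F k)) ℂ :=
  JJ (E k) (E (k + n)) * Z (k + n) * JJ (F (k + n)) (F k)

lemma shiftM_mul {E F : ℕ → ℕ} {n : ℕ} {Z : ∀ k : ℕ, Matrix (Fin (E k)) (Fin (F k)) ℂ}
    {W : ∀ k : ℕ, Matrix (Fin (F k)) (Fin (E k)) ℂ} (k : ℕ) (hE : E (k + n) = E k)
    (hF : F (k + n) = F k) (h : Z (k + n) * W (k + n) = 1) :
    shiftM n Z k * shiftM n W k = 1 := by
  calc shiftM n Z k * shiftM n W k = JJ (E k) (E (k + n)) * Z (k + n) *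
        (JJ (F (k + n)) (F k) * JJ (F k) (F (k + n))) * W (k + n) * JJ (E (k + n)) (E k) := by
          simp only [shiftM, Matrix.mul_assoc]
    _ = JJ (E k) (E (k + n)) * (Z (k + n) * W (k + n)) * JJ (E (k + n)) (E k) := by
          rw [JJ_mul hF, Matrix.mul_one]; simp only [Matrix.mul_assoc]
    _ = 1 := by rw [h, Matrix.mul_one, JJ_mul hE.symm]

lemma shift_gauge {n : ℕ} (hDper : ∀ k, D (k + n) = D k) (hD'per : ∀ k, D' (k + n) = D' k)
    (hdper : ∀ k, d (k + n) = d k)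
    (hA : ∀ k (i : Fin (d (k + n))), A (k + n) i =
      JJ (D (k + n)) (D k) * A k (Fin.cast (hdper k) i) * JJ (D (k + 1)) (D (k + n + 1)))
    (hB : ∀ k (i : Fin (d (k + n))), B (k + n) i =
      JJ (D' (k + n)) (D' k) * B k (Fin.cast (hdper k) i) * JJ (D' (k + 1)) (D' (k + n + 1)))
    {Z : ∀ k : ℕ, Matrix (Fin (D k)) (Fin (D' k)) ℂ}
    {W : ∀ k : ℕ, Matrix (Fin (D' k)) (Fin (D k)) ℂ} (k : ℕ) (μ : ℂ)
    (h : ∀ i, B (k + n) i = μ • (W (k + n) * A (k + n) i * Z (k + n + 1))) (i : Fin (d k)) :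
    B k i = μ • (shiftM n W k * A k i * shiftM n Z (k + 1)) := by
  have e := h (Fin.cast (hdper k).symm i)
  rw [hA, hB] at e
  have hi : Fin.cast (hdper k) (Fin.cast (hdper k).symm i) = i := by ext; simp
  rw [hi] at e
  have h1 : D' (k + 1) = D' (k + n + 1) := by
    rw [Nat.add_right_comm]; exact (hD'per (k + 1)).symm
  calc B k i = (JJ (D' k) (D' (k + n)) * JJ (D' (k + n)) (D' k)) * B k i *
        (JJ (D' (k + 1)) (D' (k + n + 1)) * JJ (D' (k + n + 1)) (D' (k + 1))) := by
        rw [JJ_mul h1, JJ_mul (hD'per k).symm, Matrix.mul_one, Matrix.one_mul]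
    _ = JJ (D' k) (D' (k + n)) * (JJ (D' (k + n)) (D' k) * B k i *
        JJ (D' (k + 1)) (D' (k + n + 1))) * JJ (D' (k + n + 1)) (D' (k + 1)) := by
        simp only [Matrix.mul_assoc]
    _ = _ := by
        rw [e]
        simp only [shiftM]
        rw [show k + 1 + n = k + n + 1 by omega]
        simp only [Matrix.mul_assoc, Matrix.smul_mul, Matrix.mul_smul]

lemma mpsCoeff_eq (n : ℕ) (h : D n = D 0) (i : ∀ k, Fin (d k)) :
    mpsCoeff n D d A h i = (segP A i 0 (0 + n) * JJ (D (0 + n)) (D 0)).trace := by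
  unfold mpsCoeff
  simp only [Matrix.trace, Matrix.diag, Matrix.mul_apply, segP_mprod]
  refine Finset.sum_congr rfl fun x _ => ?_
  rw [Finset.sum_eq_single (Fin.cast (show D 0 = D (0 + n) by rw [Nat.zero_add]; exact h.symm) x)]
  · simp [JJ]
  · intro y _ hy
    have : (y : ℕ) ≠ x := fun h => hy (Fin.ext h)
    simp [JJ, this]
  · simp

end global

/-- Fundamental theorem for non-translationally-invariant normal MPS on
`n ≥ 3L` sites (tensors indexed by `ℕ`, periodic with period `n`): equal states imply
the existence of cyclic gauges `Z_k`, unique up to a multiplicative constant, with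
`B_k = Z_k⁻¹ A_k Z_{k+1}`. -/
theorem fundamental_theorem_normal_MPS (n L : ℕ) (hL : 1 ≤ L) (hn : 3 * L ≤ n)
    (D D' d : ℕ → ℕ)
    (hpos : ∀ k, 0 < D k) (hpos' : ∀ k, 0 < D' k)
    (hDper : ∀ k, D (k + n) = D k) (hD'per : ∀ k, D' (k + n) = D' k)
    (hdper : ∀ k, d (k + n) = d k)
    (hDn : D n = D 0) (hD'n : D' n = D' 0)
    (A : ∀ k, Fin (d k) → Matrix (Fin (D k)) (Fin (D (k + 1))) ℂ)
    (B : ∀ k, Fin (d k) → Matrix (Fin (D' k)) (Fin (D' (k + 1))) ℂ)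
    (hAper : ∀ k (i : Fin (d (k + n))), A (k + n) i =
      (A k (Fin.cast (hdper k) i)).submatrix (Fin.cast (hDper k))
        (Fin.cast (show D (k + n + 1) = D (k + 1) by
          rw [Nat.add_right_comm]; exact hDper (k + 1))))
    (hBper : ∀ k (i : Fin (d (k + n))), B (k + n) i =
      (B k (Fin.cast (hdper k) i)).submatrix (Fin.cast (hD'per k))
        (Fin.cast (show D' (k + n + 1) = D' (k + 1) by
          rw [Nat.add_right_comm]; exact hD'per (k + 1))))
    (hAblk : ∀ a : ℕ, blockInj D d A a L)
    (hBblk : ∀ a : ℕ, blockInj D' d B a L)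
    (hstate : ∀ i : ∀ k, Fin (d k), mpsCoeff n D d A hDn i = mpsCoeff n D' d B hD'n i) :
    ∃ (Z : ∀ k : ℕ, Matrix (Fin (D k)) (Fin (D' k)) ℂ)
      (W : ∀ k : ℕ, Matrix (Fin (D' k)) (Fin (D k)) ℂ),
      (∀ k, Z k * W k = 1 ∧ W k * Z k = 1) ∧
      (∀ k i, B k i = W k * A k i * Z (k + 1)) ∧
      (∀ k, Z (k + n) = (Z k).submatrix (Fin.cast (hDper k)) (Fin.cast (hD'per k))) ∧
      ∀ (Z' : ∀ k : ℕ, Matrix (Fin (D k)) (Fin (D' k)) ℂ)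
        (W' : ∀ k : ℕ, Matrix (Fin (D' k)) (Fin (D k)) ℂ),
        (∀ k, Z' k * W' k = 1 ∧ W' k * Z' k = 1) →
        (∀ k i, B k i = W' k * A k i * Z' (k + 1)) →
        (∀ k, Z' (k + n) = (Z' k).submatrix (Fin.cast (hDper k)) (Fin.cast (hD'per k))) →
        ∃ c : ℂ, c ≠ 0 ∧ ∀ k, Z' k = c • Z k := by
  have hAi : ∀ a b, a + L ≤ b → segInj A a b := fun a b hab =>
    segInj_ge A hpos hL (fun a => segInj_of_blockInj A (hAblk a)) hab
  have hBi : ∀ a b, a + L ≤ b → segInj B a b := fun a b hab =>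
    segInj_ge B hpos' hL (fun a => segInj_of_blockInj B (hBblk a)) hab
  have hA : ∀ k (i : Fin (d (k + n))), A (k + n) i =
      JJ (D (k + n)) (D k) * A k (Fin.cast (hdper k) i) * JJ (D (k + 1)) (D (k + n + 1)) := by
    intro k i; rw [hAper, submatrix_cast]
  have hB : ∀ k (i : Fin (d (k + n))), B (k + n) i =
      JJ (D' (k + n)) (D' k) * B k (Fin.cast (hdper k) i) * JJ (D' (k + 1)) (D' (k + n + 1)) := by
    intro k i; rw [hBper, submatrix_cast]
  -- equality of states with any base point
  have hst : ∀ a i, (segP A i a (a + n) * JJ (D (a + n)) (D a)).trace =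
      (segP B i a (a + n) * JJ (D' (a + n)) (D' a)).trace := by
    intro a
    induction a with
    | zero =>
      intro i
      have := hstate i
      rwa [mpsCoeff_eq, mpsCoeff_eq] at this
    | succ a ih =>
      intro i
      rw [cyc_shift A (by omega) hDper hdper hA, cyc_shift B (by omega) hD'per hdper hB, ih]
  have hT : ∀ a b, a + L ≤ b → b + L ≤ a + n →
      ∃ T : Matrix (Fin (D a)) (Fin (D b)) ℂ ≃ₗ[ℂ] Matrix (Fin (D' a)) (Fin (D' b)) ℂ,
      ∀ i, T (segP A i a b) = segP B i a b := by
    intro a b h1 h2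
    refine exists_T A B (hAi a b h1) (hBi a b h1) (le_antisymm ?_ ?_)
    · exact ker_le A B (by omega) (by omega) _ _ _ (JJ_mul (hD'per a).symm) (hst a) (hBi _ _ h2)
    · exact ker_le B A (by omega) (by omega) _ _ _ (JJ_mul (hDper a).symm)
        (fun i => (hst a i).symm) (hAi _ _ h2)
  -- local gauges
  have hloc : ∀ k, ∃ (Z : Matrix (Fin (D k)) (Fin (D' k)) ℂ)
      (W : Matrix (Fin (D' k)) (Fin (D k)) ℂ), L ≤ k → LocalGauge A B L k Z W := by
    intro k
    by_cases hk : L ≤ k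
    · obtain ⟨a, rfl⟩ := Nat.exists_eq_add_of_le' hk
      obtain ⟨Z, W, h⟩ := exists_localGauge A B hn hpos hpos' hAi hT a
      exact ⟨Z, W, fun _ => h⟩
    · exact ⟨0, 0, fun h => absurd h hk⟩
  choose Z₀ W₀ hg using hloc
  have hex : ∀ k, ∃ i : ∀ k, Fin (d k), B k (i k) ≠ 0 := fun k =>
    site_ne B (show k < k + L by omega) (hpos' _) (hpos' _) (hBi k _ le_rfl)
  obtain ⟨i₀, -⟩ := hex 0
  have hsite : ∀ k, ∃ μ : ℂ, ∀ i, B (k + n) i =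
      μ • (W₀ (k + n) * A (k + n) i * Z₀ (k + n + 1)) := by
    intro k
    obtain ⟨a, ha, hLa⟩ : ∃ a, k + n = a + L ∧ L ≤ a := ⟨k + n - L, by omega, by omega⟩
    rw [ha]
    obtain ⟨μ, hμ⟩ := site_gauge A B hL hn hpos hpos' hAi hBi hT a (hg a hLa)
      (hg (a + L) (by omega)) (hg (a + L + 1) (by omega))
    refine ⟨μ, fun i => ?_⟩
    have := hμ (Function.update i₀ (a + L) i)
    simpa using this
  choose μ hμ using hsite
  have hμ1 : ∀ k i, B k i = μ k • (shiftM n W₀ k * A k i * shiftM n Z₀ (k + 1)) := fun k =>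
    shift_gauge A B hDper hD'per hdper hA hB k (μ k) (hμ k)
  have hμ0 : ∀ k, μ k ≠ 0 := by
    intro k h0
    obtain ⟨i, hi⟩ := hex k
    apply hi
    rw [hμ1, h0, zero_smul]
  have hinv1 : ∀ k, shiftM n Z₀ k * shiftM n W₀ k = 1 ∧ shiftM n W₀ k * shiftM n Z₀ k = 1 :=
    fun k => ⟨shiftM_mul k (hDper k) (hD'per k) (hg (k + n) (by omega)).zw,
      shiftM_mul k (hD'per k) (hDper k) (hg (k + n) (by omega)).wz⟩
  let m : ℕ → ℂ := fun k => ∏ j ∈ Finset.range k, μ j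
  have hm0 : ∀ k, m k ≠ 0 := fun k => Finset.prod_ne_zero_iff.mpr fun j _ => hμ0 j
  obtain ⟨Z, hZdef⟩ : ∃ Z : ∀ k : ℕ, Matrix (Fin (D k)) (Fin (D' k)) ℂ,
    ∀ k, Z k = m k • shiftM n Z₀ k := ⟨_, fun _ => rfl⟩
  obtain ⟨W, hWdef⟩ : ∃ W : ∀ k : ℕ, Matrix (Fin (D' k)) (Fin (D k)) ℂ,
    ∀ k, W k = (m k)⁻¹ • shiftM n W₀ k := ⟨_, fun _ => rfl⟩
  have hZW : ∀ k, Z k * W k = 1 ∧ W k * Z k = 1 := by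
    intro k
    rw [hZdef, hWdef]
    simp only [Matrix.smul_mul, Matrix.mul_smul, smul_smul, (hinv1 k).1, (hinv1 k).2,
      inv_mul_cancel₀ (hm0 k), mul_inv_cancel₀ (hm0 k), one_smul, and_self]
  have hBZ : ∀ k i, B k i = W k * A k i * Z (k + 1) := by
    intro k i
    rw [hμ1, hWdef, hZdef]
    simp only [Matrix.smul_mul, Matrix.mul_smul, smul_smul]
    congr 1
    have : m (k + 1) = m k * μ k := Finset.prod_range_succ _ _
    rw [this]
    field_simp [hm0 k]
  -- periodicity
  have hZW' : ∀ k, shiftM n Z k * shiftM n W k = 1 ∧ shiftM n W k * shiftM n Z k = 1 :=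
    fun k => ⟨shiftM_mul k (hDper k) (hD'per k) (hZW (k + n)).1,
      shiftM_mul k (hD'per k) (hDper k) (hZW (k + n)).2⟩
  have hBZ' : ∀ k i, B k i = shiftM n W k * A k i * shiftM n Z (k + 1) := by
    intro k i
    have := shift_gauge A B hDper hD'per hdper hA hB k 1
      (fun i => by rw [one_smul]; exact hBZ (k + n) i) i
    rwa [one_smul] at this
  obtain ⟨c, -, hc⟩ := gauge_unique A B hL hpos hpos' hAi hBi hZW hBZ hZW' hBZ'
  have hc1 : c = 1 := by
    obtain ⟨i, hi⟩ : ∃ i, (segP A i 0 (0 + n) * JJ (D (0 + n)) (D 0)).trace ≠ 0 := by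
      by_contra! hne
      have hJ := hAi 0 (0 + n) (by omega) _ hne
      have h2 := JJ_mul (hDper 0)
      rw [hJ, Matrix.zero_mul] at h2
      have := congrFun (congrFun h2 ⟨0, hpos _⟩) ⟨0, hpos _⟩
      simp at this
    have e1 : Z (0 + n) * JJ (D' (0 + n)) (D' 0) = c • (JJ (D (0 + n)) (D 0) * Z 0) := by
      rw [← Matrix.mul_smul, ← hc, shiftM, ← Matrix.mul_assoc, ← Matrix.mul_assoc,
        JJ_mul (hDper 0), Matrix.one_mul]
    have e2 := hst 0 i
    rw [segP_gauge A B hZW hBZ i (by omega), Matrix.mul_assoc, e1, Matrix.mul_smul,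
      Matrix.trace_smul, Matrix.mul_assoc, Matrix.trace_mul_comm (W 0)] at e2
    simp only [Matrix.mul_assoc] at e2
    rw [(hZW 0).1, Matrix.mul_one, smul_eq_mul] at e2
    exact (mul_right_cancel₀ hi (by rw [one_mul]; exact e2)).symm
  refine ⟨Z, W, hZW, hBZ, ?_, ?_⟩
  · intro k
    rw [submatrix_cast]
    have := hc k
    rw [hc1, one_smul] at this
    rw [← this]
    calc Z (k + n) = (JJ (D (k + n)) (D k) * JJ (D k) (D (k + n))) * Z (k + n) *
          (JJ (D' (k + n)) (D' k) * JJ (D' k) (D' (k + n))) := by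
          rw [JJ_mul (hDper k), JJ_mul (hD'per k), Matrix.one_mul, Matrix.mul_one]
      _ = _ := by simp only [shiftM, Matrix.mul_assoc]
  · intro Z' W' h1 h2 _
    exact gauge_unique A B hL hpos hpos' hAi hBi hZW hBZ h1 h2
end
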